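/- If G is a near-triangulation (a connected plane graph in which every bounded face is a 3-cycle), then the list 3-dynamic chromatic number of G is at most 6; that is, for every list assignment L giving each vertex a list of at least 6 colors, G admits a proper coloring φ with φ(v) ∈ L(v) for all v such that every vertex v sees at least min{3, deg_G(v)} distinct colors on its neighborhood. -/

import Mathlib

open SimpleGraph

/-- A rotation system on a finite connected simple graph: a permutation of the darts that
fixes the tail of each dart and acts transitively on the darts with a given tail
(i.e. a cyclic order of the darts around each vertex). -/
structure RotationSystem (V : Type) [Fintype V] [DecidableEq V] where
  graph : SimpleGraph V
  conn : graph.Connected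
  rot : Equiv.Perm graph.Dart
  rot_fst : ∀ d : graph.Dart, (rot d).fst = d.fst
  rot_orbit : ∀ d e : graph.Dart, d.fst = e.fst → ∃ n : ℕ, (rot ^ n) d = e

namespace RotationSystem

variable {V : Type} [Fintype V] [DecidableEq V] (P : RotationSystem V)

/-- The face-traversal permutation of the darts. -/
def facePerm : Equiv.Perm P.graph.Dart :=
  (Function.Involutive.toPerm _ (Dart.symm_involutive (G := P.graph))).trans P.rot

/-- Two darts lie on (the boundary walk of) the same face. -/
def SameFace (d e : P.graph.Dart) : Prop := P.facePerm.SameCycle d e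

/-- The faces of the embedding, as orbits of the face-traversal permutation. -/
def faceSetoid : Setoid P.graph.Dart :=
  ⟨P.facePerm.SameCycle,
    ⟨fun x => Equiv.Perm.SameCycle.refl _ x, fun h => h.symm, fun h h' => h.trans h'⟩⟩

/-- The number of faces of the embedding. -/
noncomputable def numFaces : ℕ := Nat.card (Quotient P.faceSetoid)

/-- The rotation system is a plane (genus zero) embedding: Euler's formula holds. -/
def IsPlane : Prop :=
  (Fintype.card V : ℤ) - Nat.card P.graph.edgeSet + P.numFaces = 2

/-- The number of darts on the boundary walk of the face containing dart `d`. -/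
noncomputable def faceSize (d : P.graph.Dart) : ℕ := Set.ncard {e | P.SameFace d e}

end RotationSystem

/-- A near-triangulation: a connected plane graph, with a distinguished (outer) face,
all of whose other (bounded) faces are 3-cycles. -/
structure NearTriangulation (V : Type) [Fintype V] [DecidableEq V]
    extends RotationSystem V where
  outer : graph.Dart
  plane : toRotationSystem.IsPlane
  bounded_tri : ∀ d : graph.Dart,
    ¬ toRotationSystem.SameFace outer d → toRotationSystem.faceSize d = 3

/-- A vertex lies on the boundary of the outer face. -/
def NearTriangulation.OnOuter {V : Type} [Fintype V] [DecidableEq V]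
    (P : NearTriangulation V) (v : V) : Prop :=
  ∃ d : P.graph.Dart, P.toRotationSystem.SameFace P.outer d ∧ d.fst = v

/-- An `r`-dynamic coloring: a proper coloring such that each vertex `v` sees at least
`min r (deg v)` distinct colors on its neighborhood. -/
def IsDynColoring {V : Type} (G : SimpleGraph V) (r : ℕ) (φ : V → ℕ) : Prop :=
  (∀ ⦃u v : V⦄, G.Adj u v → φ u ≠ φ v) ∧
  ∀ v : V, min r ((G.neighborSet v).ncard) ≤ (φ '' G.neighborSet v).ncard

/-- A graph with a family of triangles forming a 2-dimensional complex in which every edge lies on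
at most two triangles and every 1-cocycle over the field with two elements is a coboundary. This
class contains the near-triangulations and, unlike them, is easily seen to be closed under
contracting an edge which lies on no 3-cycle outside the family. -/
structure IsAcyclicComplex {V : Type} [DecidableEq V] (G : SimpleGraph V)
    (T : Finset (Finset V)) : Prop where
  clique : ∀ t ∈ T, G.IsNClique 3 t
  edge_le : ∀ x y, x ≠ y → (T.filter fun t => x ∈ t ∧ y ∈ t).card ≤ 2
  exact : ∀ ε : Sym2 V → ZMod 2,
    (∀ x y z, {x, y, z} ∈ T → ε s(x, y) + ε s(y, z) + ε s(x, z) = 0) →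
    ∃ f : V → ZMod 2, ∀ x y, G.Adj x y → ε s(x, y) = f x + f y

/-- Contraction of the vertex `v` into `p`; the vertex `v` remains as an isolated vertex. -/
def contractGraph {V : Type} (G : SimpleGraph V) (v p : V) : SimpleGraph V where
  Adj x y := x ≠ v ∧ y ≠ v ∧ x ≠ y ∧ (G.Adj x y ∨ (x = p ∧ G.Adj v y) ∨ (y = p ∧ G.Adj v x))
  symm := ⟨fun x y h => ⟨h.2.1, h.1, h.2.2.1.symm, by
    rcases h.2.2.2 with h | h | h
    · exact Or.inl h.symm
    · exact Or.inr (Or.inr h)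
    · exact Or.inr (Or.inl h)⟩⟩
  loopless := ⟨fun x h => h.2.2.1 rfl⟩

/-- The triangles that survive the contraction of `v` into `p`. -/
def contractTriangles {V : Type} [DecidableEq V] (T : Finset (Finset V)) (v p : V) :
    Finset (Finset V) :=
  (T.filter fun t => ¬ (v ∈ t ∧ p ∈ t)).image fun t => t.image (Function.update id v p)


/-- The simplicial coboundary from 1-cochains to 2-cochains, over the field with two elements. -/
noncomputable def coboundary {V : Type} [DecidableEq V] (T : Finset (Finset V)) :
    (Sym2 V → ZMod 2) →ₗ[ZMod 2] (T → ZMod 2) :=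
  LinearMap.pi fun t => ∑ e ∈ t.1.sym2.filter fun e => ¬ e.IsDiag, LinearMap.proj e

theorem coboundary_apply {V : Type} [DecidableEq V] (T : Finset (Finset V)) (ε : Sym2 V → ZMod 2)
    {x y z : V} (h : {x, y, z} ∈ T) (hxy : x ≠ y) (hyz : y ≠ z) (hxz : x ≠ z) :
    coboundary T ε ⟨{x, y, z}, h⟩ = ε s(x, y) + ε s(y, z) + ε s(x, z) := by
  have : ((({x, y, z} : Finset V)).sym2.filter fun e => ¬ e.IsDiag) =
      {s(x, y), s(y, z), s(x, z)} := by
    ext e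
    induction e with | _ a b
    simp only [Finset.mem_filter, Finset.mk_mem_sym2_iff, Finset.mem_insert, Finset.mem_singleton,
      Sym2.mk_isDiag_iff, Sym2.eq_iff]
    grind
  simp only [coboundary, LinearMap.pi_apply, LinearMap.sum_apply, LinearMap.proj_apply, this]
  rw [Finset.sum_insert, Finset.sum_pair, add_assoc]
  · simp; grind
  · simp; grind

theorem mem_image_update {V : Type} [DecidableEq V] {t : Finset V} {v p x : V} (hx : x ≠ v) :
    x ∈ t.image (Function.update id v p) ↔ x ∈ t ∨ (x = p ∧ v ∈ t) := by
  simp only [Finset.mem_image, Function.update_apply, id]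
  constructor
  · rintro ⟨y, hy, rfl⟩
    split_ifs with h
    · exact Or.inr ⟨rfl, h ▸ hy⟩
    · exact Or.inl hy
  · rintro (h | ⟨rfl, h⟩)
    · exact ⟨x, h, if_neg hx⟩
    · exact ⟨v, h, if_pos rfl⟩

theorem not_mem_image_update {V : Type} [DecidableEq V] {t : Finset V} {v p : V} (hp : p ≠ v) :
    v ∉ t.image (Function.update id v p) := by
  simp only [Finset.mem_image, Function.update_apply, id, not_exists, not_and]
  intro y _
  split_ifs with h
  · exact hp
  · exact h

theorem IsAcyclicComplex.adj_of_mem {V : Type} [DecidableEq V] {G : SimpleGraph V}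
    {T : Finset (Finset V)} (h : IsAcyclicComplex G T) {t : Finset V} (ht : t ∈ T) {x y : V}
    (hx : x ∈ t) (hy : y ∈ t) (hxy : x ≠ y) : G.Adj x y :=
  (h.clique t ht).isClique hx hy hxy

theorem IsAcyclicComplex.eq_triple {V : Type} [DecidableEq V] {G : SimpleGraph V}
    {T : Finset (Finset V)} (h : IsAcyclicComplex G T) {t : Finset V} (ht : t ∈ T) {x y z : V}
    (hx : x ∈ t) (hy : y ∈ t) (hz : z ∈ t) (hxy : x ≠ y) (hyz : y ≠ z) (hxz : x ≠ z) :
    t = {x, y, z} := by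
  refine (Finset.eq_of_subset_of_card_le ?_ ?_).symm
  · intro w hw
    simp only [Finset.mem_insert, Finset.mem_singleton] at hw
    rcases hw with rfl | rfl | rfl <;> assumption
  · rw [(h.clique t ht).card_eq, Finset.card_eq_three.mpr ⟨x, y, z, hxy, hxz, hyz, rfl⟩]

theorem IsAcyclicComplex.exists_third {V : Type} [DecidableEq V] {G : SimpleGraph V}
    {T : Finset (Finset V)} (h : IsAcyclicComplex G T) {t : Finset V} (ht : t ∈ T) {x y : V}
    (hx : x ∈ t) (hy : y ∈ t) (hxy : x ≠ y) : ∃ z, z ≠ x ∧ z ≠ y ∧ t = {x, y, z} := by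
  have hcard : 0 < ((t.erase x).erase y).card := by
    rw [Finset.card_erase_of_mem (Finset.mem_erase.mpr ⟨hxy.symm, hy⟩),
      Finset.card_erase_of_mem hx, (h.clique t ht).card_eq]
    norm_num
  obtain ⟨z, hz⟩ := Finset.card_pos.mp hcard
  simp only [Finset.mem_erase] at hz
  exact ⟨z, hz.2.1, hz.1, h.eq_triple ht hx hy hz.2.2 hxy hz.1.symm hz.2.1.symm⟩

theorem IsAcyclicComplex.ne_of_mem {V : Type} [DecidableEq V] {G : SimpleGraph V}
    {T : Finset (Finset V)} (h : IsAcyclicComplex G T) {x y z : V} (ht : {x, y, z} ∈ T) :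
    x ≠ y ∧ y ≠ z ∧ x ≠ z := by
  have hc := (h.clique _ ht).card_eq
  have h2 : ∀ a b : V, ({a, b} : Finset V).card ≠ 3 := fun a b =>
    (Finset.card_le_two.trans_lt (by norm_num)).ne
  refine ⟨?_, ?_, ?_⟩ <;> rintro rfl <;> simp_all

/-- Contracting an edge which lies on no 3-cycle outside the family preserves acyclicity. -/
theorem IsAcyclicComplex.contract {V : Type} [DecidableEq V] {G : SimpleGraph V}
    {T : Finset (Finset V)} (h : IsAcyclicComplex G T) {v p : V} (hvp : G.Adj v p)
    (hlink : ∀ x, G.Adj v x → G.Adj p x → {v, p, x} ∈ T) :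
    IsAcyclicComplex (contractGraph G v p) (contractTriangles T v p) := by
  have hpv : p ≠ v := hvp.ne'
  refine ⟨?_, ?_, ?_⟩
  · intro t' ht'
    obtain ⟨t, ht, rfl⟩ := Finset.mem_image.mp ht'
    obtain ⟨htT, hnot⟩ := Finset.mem_filter.mp ht
    refine ⟨?_, ?_⟩
    · intro x hx y hy hxy
      have hxv : x ≠ v := fun e => not_mem_image_update hpv (e ▸ hx)
      have hyv : y ≠ v := fun e => not_mem_image_update hpv (e ▸ hy)
      refine ⟨hxv, hyv, hxy, ?_⟩
      rcases (mem_image_update hxv).mp hx with hx' | ⟨rfl, hx'⟩ <;>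
      rcases (mem_image_update hyv).mp hy with hy' | ⟨hy', hy''⟩
      · exact Or.inl (h.adj_of_mem htT hx' hy' hxy)
      · exact Or.inr (Or.inr ⟨hy', h.adj_of_mem htT hy'' hx' hxv.symm⟩)
      · exact Or.inr (Or.inl ⟨rfl, h.adj_of_mem htT hx' hy' hyv.symm⟩)
      · exact absurd hy'.symm hxy
    · rw [Finset.card_image_of_injOn, (h.clique t htT).card_eq]
      intro x hx y hy hxy
      simp only [Function.update_apply, id] at hxy
      split_ifs at hxy with h1 h2 h2
      · rw [h1, h2]
      · exact absurd ⟨h1 ▸ hx, hxy ▸ hy⟩ hnot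
      · exact absurd ⟨h2 ▸ hy, hxy ▸ hx⟩ hnot
      · exact hxy
  · have main : ∀ y, y ≠ p → y ≠ v →
        ((contractTriangles T v p).filter fun t => p ∈ t ∧ y ∈ t).card ≤ 2 := by
      intro y hyp hyv
      let A := (T.filter fun t => p ∈ t ∧ y ∈ t).erase {v, p, y}
      let B := (T.filter fun t => v ∈ t ∧ y ∈ t).erase {v, p, y}
      have hsub : ((contractTriangles T v p).filter fun t => p ∈ t ∧ y ∈ t) ⊆
          (A ∪ B).image fun t => t.image (Function.update id v p) := by
        intro t' ht'
        obtain ⟨ht', hp, hy⟩ := Finset.mem_filter.mp ht'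
        obtain ⟨t, ht, rfl⟩ := Finset.mem_image.mp ht'
        obtain ⟨ht, hnot⟩ := Finset.mem_filter.mp ht
        refine Finset.mem_image_of_mem _ ?_
        have hne : t ≠ {v, p, y} := fun e => hnot (by simp [e])
        rw [mem_image_update hpv] at hp
        rw [mem_image_update hyv] at hy
        simp only [A, B, Finset.mem_union, Finset.mem_erase, Finset.mem_filter]
        tauto
      refine (Finset.card_le_card hsub).trans (Finset.card_image_le.trans
        ((Finset.card_union_le _ _).trans ?_))
      have hA := h.edge_le p y hyp.symm
      have hB := h.edge_le v y hyv.symm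
      by_cases hm : {v, p, y} ∈ T
      · have hA' : A.card + 1 = (T.filter fun t => p ∈ t ∧ y ∈ t).card :=
          Finset.card_erase_add_one (by simp [hm])
        have hB' : B.card + 1 = (T.filter fun t => v ∈ t ∧ y ∈ t).card :=
          Finset.card_erase_add_one (by simp [hm])
        omega
      · have hA' : A.card ≤ _ := Finset.card_erase_le
        have hB' : B.card ≤ _ := Finset.card_erase_le
        by_cases hvy : G.Adj v y
        · have : (T.filter fun t => p ∈ t ∧ y ∈ t) = ∅ :=
            Finset.filter_eq_empty_iff.mpr fun t ht hpy =>
              hm (hlink y hvy (h.adj_of_mem ht hpy.1 hpy.2 hyp.symm))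
          rw [this, Finset.card_empty] at hA'
          omega
        · have : (T.filter fun t => v ∈ t ∧ y ∈ t) = ∅ :=
            Finset.filter_eq_empty_iff.mpr fun t ht hpy =>
              hvy (h.adj_of_mem ht hpy.1 hpy.2 hyv.symm)
          rw [this, Finset.card_empty] at hB'
          omega
    intro x y hxy
    by_cases hxv : x = v
    · refine (Finset.card_eq_zero.mpr (Finset.filter_eq_empty_iff.mpr ?_)).le.trans zero_le_two
      intro t' ht'
      obtain ⟨t, ht, rfl⟩ := Finset.mem_image.mp ht'
      exact fun hh => not_mem_image_update hpv (hxv ▸ hh.1)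
    by_cases hyv : y = v
    · refine (Finset.card_eq_zero.mpr (Finset.filter_eq_empty_iff.mpr ?_)).le.trans zero_le_two
      intro t' ht'
      obtain ⟨t, ht, rfl⟩ := Finset.mem_image.mp ht'
      exact fun hh => not_mem_image_update hpv (hyv ▸ hh.2)
    by_cases hxp : x = p
    · subst hxp
      exact main y hxy.symm hyv
    by_cases hyp : y = p
    · subst hyp
      simpa only [and_comm] using main x hxp hxv
    refine le_trans ?_ (h.edge_le x y hxy)
    refine le_trans (Finset.card_le_card (t := (T.filter fun t => x ∈ t ∧ y ∈ t).image
      fun t => t.image (Function.update id v p)) ?_) Finset.card_image_le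
    intro t' ht'
    obtain ⟨ht', hx, hy⟩ := Finset.mem_filter.mp ht'
    obtain ⟨t, ht, rfl⟩ := Finset.mem_image.mp ht'
    obtain ⟨ht, hnot⟩ := Finset.mem_filter.mp ht
    refine Finset.mem_image_of_mem _ ?_
    rw [mem_image_update hxv] at hx
    rw [mem_image_update hyv] at hy
    simp only [Finset.mem_filter]
    tauto
  · intro ε hε
    let π : V → V := Function.update id v p
    have πv : π v = p := Function.update_self ..
    have πn : ∀ x, x ≠ v → π x = x := fun x hx => Function.update_of_ne hx ..
    obtain ⟨f, hf⟩ := h.exact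
      (fun e => if (e.map π).IsDiag then 0 else ε (e.map π)) (by
        intro x y z ht
        obtain ⟨hxy, hyz, hxz⟩ := h.ne_of_mem ht
        by_cases hb : v ∈ ({x, y, z} : Finset V) ∧ p ∈ ({x, y, z} : Finset V)
        · have key : ∀ w, w ≠ v → w ≠ p → π w = w ∧ p ≠ w := fun w hw hw' => ⟨πn w hw, hw'.symm⟩
          have hpp : π p = p := πn p hpv
          have char2 : ∀ a : ZMod 2, a + a = 0 := CharTwo.add_self_eq_zero
          simp only [Finset.mem_insert, Finset.mem_singleton] at hb
          simp only [Sym2.map_mk, Sym2.mk_isDiag_iff]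
          rcases hb with ⟨rfl | rfl | rfl, rfl | rfl | rfl⟩ <;>
            first
            | exact absurd rfl hpv
            | (simp only [πv, hpp, if_true, zero_add, add_zero]
               grind [Sym2.eq_swap])
        · have hm := hε (π x) (π y) (π z) (by
            refine Finset.mem_image.mpr ⟨{x, y, z}, Finset.mem_filter.mpr ⟨ht, hb⟩, ?_⟩
            simp [π, Finset.image_insert])
          have hinj : ∀ a ∈ ({x, y, z} : Finset V), ∀ b ∈ ({x, y, z} : Finset V),
              a ≠ b → π a ≠ π b := by
            intro a ha b hb' hab e
            by_cases h1 : a = v <;> by_cases h2 : b = v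
            · exact hab (h1.trans h2.symm)
            · rw [h1, πv, πn b h2] at e
              exact hb ⟨h1 ▸ ha, e ▸ hb'⟩
            · rw [h2, πv, πn a h1] at e
              exact hb ⟨h2 ▸ hb', e ▸ ha⟩
            · rw [πn a h1, πn b h2] at e
              exact hab e
          simp only [Sym2.map_mk, Sym2.mk_isDiag_iff]
          rwa [if_neg (hinj x (by simp) y (by simp) hxy),
            if_neg (hinj y (by simp) z (by simp) hyz),
            if_neg (hinj x (by simp) z (by simp) hxz)])
    have hvpf : f v = f p := by
      have := hf v p hvp
      simp only [Sym2.map_mk, Sym2.mk_isDiag_iff, πv, πn p hpv, if_true] at this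
      exact CharTwo.add_eq_zero.mp this.symm
    refine ⟨f, fun x y hxy => ?_⟩
    obtain ⟨hxv, hyv, hne, h1 | ⟨rfl, h1⟩ | ⟨rfl, h1⟩⟩ := hxy
    · have := hf x y h1
      simpa only [Sym2.map_mk, Sym2.mk_isDiag_iff, πn x hxv, πn y hyv, if_neg hne] using this
    · have := hf v y h1
      simpa only [Sym2.map_mk, Sym2.mk_isDiag_iff, πv, πn y hyv, if_neg hne, hvpf] using this
    · have := hf v x h1
      rw [Sym2.eq_swap, add_comm]
      simpa only [Sym2.map_mk, Sym2.mk_isDiag_iff, πv, πn x hxv, if_neg hne.symm, hvpf] using this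

theorem ncard_edgeSet_contractGraph_lt {V : Type} [Fintype V] [DecidableEq V] {G : SimpleGraph V}
    {v p : V} (hvp : G.Adj v p) :
    (contractGraph G v p).edgeSet.ncard < G.edgeSet.ncard := by
  have hsub : (contractGraph G v p).edgeSet ⊆
      Sym2.map (Function.update id v p) '' (G.edgeSet \ {s(v, p)}) := by
    intro e
    induction e with | _ x y
    rintro ⟨hxv, hyv, hne, h1⟩
    have hn : ∀ x, x ≠ v → Function.update id v p x = x := fun x hx => Function.update_of_ne hx ..
    have hv : Function.update id v p v = p := Function.update_self ..
    rcases h1 with h1 | ⟨rfl, h1⟩ | ⟨rfl, h1⟩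
    · refine ⟨s(x, y), ⟨h1, ?_⟩, by simp [hn x hxv, hn y hyv]⟩
      simp only [Set.mem_singleton_iff, Sym2.eq_iff]
      tauto
    · refine ⟨s(v, y), ⟨h1, ?_⟩, by simp [hn y hyv]⟩
      simp only [Set.mem_singleton_iff, Sym2.eq_iff]
      grind
    · refine ⟨s(v, x), ⟨h1, ?_⟩, by simp [hn x hxv, Sym2.eq_swap]⟩
      simp only [Set.mem_singleton_iff, Sym2.eq_iff]
      grind
  refine ((Set.ncard_le_ncard hsub (Set.toFinite _)).trans
    (Set.ncard_image_le (Set.toFinite _))).trans_lt ?_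
  exact Set.ncard_sdiff_singleton_lt_of_mem hvp (Set.toFinite _)

theorem IsAcyclicComplex.exists_of_mem_ker {V : Type} [DecidableEq V] {G : SimpleGraph V}
    {T : Finset (Finset V)} (h : IsAcyclicComplex G T) {ε : Sym2 V → ZMod 2}
    (hε : coboundary T ε = 0) :
    ∃ f : V → ZMod 2, ∀ x y, G.Adj x y → ε s(x, y) = f x + f y := by
  refine h.exact ε fun x y z ht => ?_
  obtain ⟨hxy, hyz, hxz⟩ := h.ne_of_mem ht
  rw [← coboundary_apply T ε ht hxy hyz hxz, hε, Pi.zero_apply]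

theorem coboundary_single {V : Type} [DecidableEq V] (T : Finset (Finset V)) {x y : V}
    (hxy : x ≠ y) :
    coboundary T (Pi.single s(x, y) 1) =
      ∑ t : T, if x ∈ t.1 ∧ y ∈ t.1 then Pi.single t 1 else 0 := by
  ext t
  have h1 : coboundary T (Pi.single s(x, y) 1) t = if x ∈ t.1 ∧ y ∈ t.1 then 1 else 0 := by
    simp [coboundary, Pi.single_apply, hxy]
  rw [h1, Finset.sum_apply, Finset.sum_eq_single t]
  · split_ifs <;> simp
  · intro u _ hu
    split_ifs <;> simp [hu.symm]
  · simp

/-- Every triangle of the graph is a boundary modulo two. -/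
theorem IsAcyclicComplex.exists_filling {V : Type} [Fintype V] [DecidableEq V] {G : SimpleGraph V}
    {T : Finset (Finset V)} (h : IsAcyclicComplex G T) {a b c : V}
    (hab : G.Adj a b) (hbc : G.Adj b c) (hac : G.Adj a c) :
    ∃ s : Finset V → ZMod 2, ∀ x y, x ≠ y →
      ∑ t ∈ T with x ∈ t ∧ y ∈ t, s t =
        if s(x, y) = s(a, b) ∨ s(x, y) = s(b, c) ∨ s(x, y) = s(a, c) then 1 else 0 := by
  let z : Module.Dual (ZMod 2) (Sym2 V → ZMod 2) :=
    LinearMap.proj (R := ZMod 2) (φ := fun _ => ZMod 2) s(a, b) +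
      LinearMap.proj (R := ZMod 2) (φ := fun _ => ZMod 2) s(b, c) +
      LinearMap.proj (R := ZMod 2) (φ := fun _ => ZMod 2) s(a, c)
  have hz : z ∈ (coboundary T).dualMap.range := by
    rw [LinearMap.range_dualMap_eq_dualAnnihilator_ker, Submodule.mem_dualAnnihilator]
    intro ε hε
    obtain ⟨f, hf⟩ := h.exists_of_mem_ker (LinearMap.mem_ker.mp hε)
    change ε s(a, b) + ε s(b, c) + ε s(a, c) = 0
    rw [hf _ _ hab, hf _ _ hbc, hf _ _ hac]
    have char2 : ∀ a : ZMod 2, a + a = 0 := CharTwo.add_self_eq_zero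
    linear_combination char2 (f a) + char2 (f b) + char2 (f c)
  obtain ⟨g, hg⟩ := hz
  classical
  refine ⟨fun t => if ht : t ∈ T then g (Pi.single ⟨t, ht⟩ 1) else 0, fun x y hxy => ?_⟩
  have h1 := congrArg (fun l => l (Pi.single s(x, y) 1)) hg
  simp only [LinearMap.dualMap_apply, coboundary_single T hxy, map_sum] at h1
  rw [Finset.sum_filter, ← Finset.sum_coe_sort]
  have h2 : z (Pi.single s(x, y) 1) =
      if s(x, y) = s(a, b) ∨ s(x, y) = s(b, c) ∨ s(x, y) = s(a, c) then 1 else 0 := by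
    have := hab.ne
    have := hbc.ne
    have := hac.ne
    simp only [z, LinearMap.add_apply, LinearMap.proj_apply, Pi.single_apply, eq_comm (b := s(x, y))]
    have h12 : s(a, b) ≠ s(b, c) := by simp; grind
    have h13 : s(a, b) ≠ s(a, c) := by simp; grind
    have h23 : s(b, c) ≠ s(a, c) := by simp; grind
    generalize s(a, b) = p at *
    generalize s(b, c) = q at *
    generalize s(a, c) = r at *
    generalize s(x, y) = e at *
    clear h1 hg
    split_ifs <;> grind
  rw [← h2, ← h1]
  refine Finset.sum_congr rfl fun t _ => ?_
  split_ifs <;> simp_all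

/-- If the edge `vc` lies on the two triangles `vbc` and `vcd`, then another common neighbour of
`v` and `c` prevents `b` and `d` from being adjacent. -/
theorem IsAcyclicComplex.not_adj_of_common_neighbor {V : Type} [Fintype V] [DecidableEq V]
    {G : SimpleGraph V} {T : Finset (Finset V)} (h : IsAcyclicComplex G T) {v a b c d : V}
    (hb : {v, b, c} ∈ T) (hd : {v, c, d} ∈ T) (hbd : b ≠ d) (hab : a ≠ b) (had : a ≠ d)
    (hva : G.Adj v a) (hac : G.Adj a c) : ¬ G.Adj b d := by
  intro hadj
  obtain ⟨hvb, hbc, hvc⟩ := h.ne_of_mem hb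
  obtain ⟨-, hcd, hvd⟩ := h.ne_of_mem hd
  have avb := h.adj_of_mem hb (x := v) (y := b) (by simp) (by simp) hvb
  have avd := h.adj_of_mem hd (x := v) (y := d) (by simp) (by simp) hvd
  have avc := h.adj_of_mem hb (x := v) (y := c) (by simp) (by simp) hvc
  have hva' := hva.ne
  have hac' := hac.ne
  obtain ⟨s, hs⟩ := h.exists_filling hva hac avc
  have key : ∀ u, u ≠ v → u ≠ a → u ≠ c → ∀ x, x ≠ u → ∀ t ∈ T, ∀ t' ∈ T, u ∈ t → x ∈ t →
      u ∈ t' → x ∈ t' → s t = s t' := by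
    intro u huv hua huc x hxu t ht t' ht' h1 h2 h3 h4
    by_cases htt : t = t'
    · rw [htt]
    have heq : (T.filter fun t => u ∈ t ∧ x ∈ t) = {t, t'} := by
      refine (Finset.eq_of_subset_of_card_le ?_ ?_).symm
      · intro w hw
        simp only [Finset.mem_insert, Finset.mem_singleton] at hw
        rcases hw with rfl | rfl <;> simp [*]
      · rw [Finset.card_pair htt]
        exact h.edge_le u x hxu.symm
    have := hs u x hxu.symm
    rw [heq, Finset.sum_pair htt, if_neg] at this
    · exact CharTwo.add_eq_zero.mp this
    · simp only [Sym2.eq_iff]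
      grind
  classical
  let σ : V → V → ZMod 2 := fun u x => if ∃ t ∈ T, u ∈ t ∧ x ∈ t ∧ s t = 1 then 1 else 0
  have σ_eq : ∀ u, u ≠ v → u ≠ a → u ≠ c → ∀ x, x ≠ u → ∀ t ∈ T, u ∈ t → x ∈ t →
      σ u x = s t := by
    intro u huv hua huc x hxu t ht hut hxt
    simp only [σ]
    split_ifs with hex
    · obtain ⟨t', ht', h1, h2, h3⟩ := hex
      rw [← h3]
      exact key u huv hua huc x hxu t' ht' t ht h1 h2 hut hxt
    · have : s t ≠ 1 := fun e => hex ⟨t, ht, hut, hxt, e⟩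
      generalize s t = r at this
      revert this
      revert r
      decide
  have σ_symm : ∀ u x, σ u x = σ x u := by
    intro u x
    simp only [σ]
    congr 1
    simp only [eq_iff_iff]
    exact exists_congr fun t => by tauto
  have around : ∀ u w, u ≠ v → u ≠ a → u ≠ c → w ≠ v → w ≠ u → G.Adj u v → G.Adj u w →
      G.Adj v w → σ u v = σ u w := by
    intro u w huv hua huc hwv hwu h1 h2 h3
    let ε : Sym2 V → ZMod 2 := fun e => if he : u ∈ e then σ u (Sym2.Mem.other he) else 0
    have ε1 : ∀ x, ε s(u, x) = σ u x := by
      intro x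
      have hm : u ∈ s(u, x) := Sym2.mem_mk_left u x
      simp only [ε, hm, dif_pos]
      congr 1
      exact Sym2.congr_right.mp (Sym2.other_spec hm)
    have ε0 : ∀ x y, x ≠ u → y ≠ u → ε s(x, y) = 0 := by
      intro x y hx hy
      have : u ∉ s(x, y) := by simp [hx.symm, hy.symm]
      simp [ε, this]
    obtain ⟨f, hf⟩ := h.exact ε (by
      intro x y z ht
      obtain ⟨hxy, hyz, hxz⟩ := h.ne_of_mem ht
      have hσ := fun w hw hwt hut => σ_eq u huv hua huc w hw _ ht hut hwt
      by_cases hx : x = u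
      · subst hx
        rw [ε1, ε0 _ _ hxy.symm hxz.symm, ε1, hσ y hxy.symm (by simp) (by simp),
          hσ z hxz.symm (by simp) (by simp), add_zero, CharTwo.add_self_eq_zero]
      by_cases hy : y = u
      · subst hy
        rw [ε1, ε0 _ _ hxy hyz.symm, Sym2.eq_swap, ε1, hσ x hxy (by simp) (by simp),
          hσ z hyz.symm (by simp) (by simp), add_zero, CharTwo.add_self_eq_zero]
      by_cases hz : z = u
      · subst hz
        rw [ε0 _ _ hxz hyz, Sym2.eq_swap, ε1, Sym2.eq_swap, ε1, hσ x hxz (by simp) (by simp),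
          hσ y hyz (by simp) (by simp), zero_add, CharTwo.add_self_eq_zero]
      rw [ε0 _ _ hx hy, ε0 _ _ hy hz, ε0 _ _ hx hz]
      simp)
    have e1 := hf u v h1
    have e2 := hf u w h2
    have e3 := hf v w h3
    rw [ε1] at e1 e2
    rw [ε0 v w huv.symm hwu] at e3
    rw [e1, e2, CharTwo.add_eq_zero.mp e3.symm]
  have h1 := around b d hvb.symm hab.symm hbc hvd.symm hbd.symm avb.symm hadj avd
  have h2 := around d b hvd.symm had.symm hcd.symm hvb.symm hbd avd.symm hadj.symm avb
  rw [σ_symm d b, ← h1, σ_eq d hvd.symm had.symm hcd.symm v hvd _ hd (by simp) (by simp),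
    σ_eq b hvb.symm hab.symm hbc v hvb _ hb (by simp) (by simp)] at h2
  have hne : ({v, b, c} : Finset V) ≠ {v, c, d} := by
    intro e
    have : b ∈ ({v, c, d} : Finset V) := e ▸ (by simp)
    simp only [Finset.mem_insert, Finset.mem_singleton] at this
    grind
  have heq : (T.filter fun t => v ∈ t ∧ c ∈ t) = {{v, b, c}, {v, c, d}} := by
    refine (Finset.eq_of_subset_of_card_le ?_ ?_).symm
    · intro w hw
      simp only [Finset.mem_insert, Finset.mem_singleton] at hw
      rcases hw with rfl | rfl <;> simp [*]
    · rw [Finset.card_pair hne]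
      exact h.edge_le v c hvc
  have := hs v c hvc
  rw [heq, Finset.sum_pair hne, if_pos (by simp), h2, CharTwo.add_self_eq_zero] at this
  exact zero_ne_one this

theorem sum_ite_mem_sym2 {V : Type} [Fintype V] [DecidableEq V] {S : Set V} [Fintype S]
    (f : S → ZMod 2) {x y : S} (hxy : x ≠ y) :
    ∑ w : S, (if w.1 ∈ s(x.1, y.1) then f w else 0) = f x + f y := by
  rw [← Finset.sum_filter, show (Finset.univ.filter fun w : S => w.1 ∈ s(x.1, y.1)) = {x, y} by
    ext w; simp [Subtype.ext_iff], Finset.sum_pair hxy]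

/-- The Euler characteristic of an acyclic complex without isolated vertices is positive. -/
theorem IsAcyclicComplex.card_edgeSet_lt {V : Type} [Fintype V] [DecidableEq V]
    {G : SimpleGraph V} {T : Finset (Finset V)} (h : IsAcyclicComplex G T)
    (hne : G.support.Nonempty) :
    G.edgeSet.ncard < G.support.ncard + T.card := by
  classical
  let D : (G.support → ZMod 2) →ₗ[ZMod 2] (G.edgeSet → ZMod 2) := LinearMap.pi fun e =>
    ∑ w : G.support, if w.1 ∈ e.1 then LinearMap.proj (R := ZMod 2) (φ := fun _ => ZMod 2) w else 0
  have hD : ∀ f x y (hxy : G.Adj x y),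
      D f ⟨s(x, y), hxy⟩ = f ⟨x, y, hxy⟩ + f ⟨y, x, hxy.symm⟩ := by
    intro f x y hxy
    rw [← sum_ite_mem_sym2 f (x := ⟨x, y, hxy⟩) (y := ⟨y, x, hxy.symm⟩)
      (fun e => hxy.ne (congrArg Subtype.val e))]
    simp only [D, LinearMap.pi_apply, LinearMap.sum_apply]
    refine Finset.sum_congr rfl fun w _ => ?_
    split_ifs <;> rfl
  let Z := (coboundary T ∘ₗ Function.ExtendByZero.linearMap (ZMod 2) (Subtype.val : G.edgeSet → Sym2 V))
  have hZ : Z.ker ≤ D.range := by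
    intro ε hε
    obtain ⟨f, hf⟩ := h.exists_of_mem_ker (LinearMap.mem_ker.mp hε)
    refine ⟨fun v => f v, ?_⟩
    ext ⟨e, he⟩
    induction e with | _ x y
    refine (hD _ x y he).trans ((hf x y he).symm.trans ?_)
    exact Subtype.val_injective.extend_apply ε 0 (⟨s(x, y), he⟩ : G.edgeSet)
  have h1 := Z.finrank_range_add_finrank_ker
  have h2 := D.finrank_range_add_finrank_ker
  have h3 : Module.finrank (ZMod 2) Z.range ≤ T.card := by
    refine (Submodule.finrank_le _).trans ?_
    rw [Module.finrank_fintype_fun_eq_card, Fintype.card_coe]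
  have h4 := (Nat.add_le_add_right (Submodule.finrank_mono hZ) _).trans_eq h2
  have h5 : 0 < Module.finrank (ZMod 2) D.ker := by
    obtain ⟨v, hv⟩ := hne
    refine Module.finrank_pos_iff_exists_ne_zero.mpr ⟨⟨fun _ => 1, ?_⟩, ?_⟩
    · rw [LinearMap.mem_ker]
      ext ⟨e, he⟩
      induction e with | _ x y
      exact (hD _ x y he).trans (CharTwo.add_self_eq_zero _)
    · intro e
      exact one_ne_zero (congrFun (congrArg Subtype.val e) ⟨v, hv⟩)
  rw [Module.finrank_fintype_fun_eq_card, ← Nat.card_eq_fintype_card, Nat.card_coe_set_eq] at h1 h4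
  omega

theorem sum_ncard_neighborSet {V : Type} [Fintype V] (G : SimpleGraph V) :
    ∑ v, (G.neighborSet v).ncard = 2 * G.edgeSet.ncard := by
  classical
  rw [Set.ncard_eq_toFinset_card', ← edgeFinset, ← sum_degrees_eq_twice_card_edges]
  refine Finset.sum_congr rfl fun v _ => ?_
  rw [Set.ncard_eq_toFinset_card', ← card_neighborFinset_eq_degree, neighborFinset]

theorem IsAcyclicComplex.sum_card_triangles {V : Type} [Fintype V] [DecidableEq V]
    {G : SimpleGraph V} {T : Finset (Finset V)} (h : IsAcyclicComplex G T) :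
    ∑ v, (T.filter fun t => v ∈ t).card = 3 * T.card := by
  have := Finset.sum_card_bipartiteAbove_eq_sum_card_bipartiteBelow (fun (v : V) t => v ∈ t)
    (s := Finset.univ) (t := T)
  simp only [Finset.bipartiteAbove, Finset.bipartiteBelow] at this
  rw [this, mul_comm, ← smul_eq_mul, ← Finset.sum_const]
  refine Finset.sum_congr rfl fun t ht => ?_
  rw [Finset.filter_univ_mem, (h.clique t ht).card_eq]

theorem IsAcyclicComplex.two_mul_card_triangles {V : Type} [Fintype V] [DecidableEq V]
    {G : SimpleGraph V} {T : Finset (Finset V)} (h : IsAcyclicComplex G T) (v : V) :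
    ∑ x ∈ (Set.toFinite (G.neighborSet v)).toFinset, (T.filter fun t => v ∈ t ∧ x ∈ t).card =
      2 * (T.filter fun t => v ∈ t).card := by
  have := Finset.sum_card_bipartiteAbove_eq_sum_card_bipartiteBelow (fun (x : V) t => x ∈ t)
    (s := (Set.toFinite (G.neighborSet v)).toFinset) (t := T.filter fun t => v ∈ t)
  simp only [Finset.bipartiteAbove, Finset.bipartiteBelow, Finset.filter_filter] at this
  rw [this, mul_comm, ← smul_eq_mul, ← Finset.sum_const]
  refine Finset.sum_congr rfl fun t ht => ?_
  obtain ⟨ht, hvt⟩ := Finset.mem_filter.mp ht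
  have heq : ((Set.toFinite (G.neighborSet v)).toFinset.filter fun x => x ∈ t) = t.erase v := by
    ext x
    simp only [Finset.mem_filter, Set.Finite.mem_toFinset, mem_neighborSet, Finset.mem_erase]
    exact ⟨fun hx => ⟨hx.1.ne', hx.2⟩, fun hx => ⟨h.adj_of_mem ht hvt hx.2 hx.1.symm, hx.2⟩⟩
  rw [heq, Finset.card_erase_of_mem hvt, (h.clique t ht).card_eq]

/-- The charge of a vertex; the charges of an acyclic complex have a positive sum. -/
noncomputable def charge {V : Type} [Fintype V] [DecidableEq V] (G : SimpleGraph V)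
    (T : Finset (Finset V)) (v : V) : ℤ :=
  6 - 3 * (G.neighborSet v).ncard + 2 * (T.filter fun t => v ∈ t).card

theorem IsAcyclicComplex.sum_charge_pos {V : Type} [Fintype V] [DecidableEq V]
    {G : SimpleGraph V} {T : Finset (Finset V)} (h : IsAcyclicComplex G T)
    (hne : G.support.Nonempty) :
    0 < ∑ v ∈ (Set.toFinite G.support).toFinset, charge G T v := by
  have h1 := h.card_edgeSet_lt hne
  have h2 := sum_ncard_neighborSet G
  have h3 := h.sum_card_triangles
  have h4 : ∑ v ∈ (Set.toFinite G.support).toFinset, (G.neighborSet v).ncard =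
      ∑ v, (G.neighborSet v).ncard := by
    refine Finset.sum_subset (Finset.subset_univ _) fun v _ hv => ?_
    rw [Set.ncard_eq_zero]
    refine Set.eq_empty_of_forall_notMem fun w hw => hv ?_
    exact (Set.Finite.mem_toFinset _).mpr ⟨w, hw⟩
  have h5 : ∑ v ∈ (Set.toFinite G.support).toFinset, (T.filter fun t => v ∈ t).card =
      ∑ v, (T.filter fun t => v ∈ t).card := by
    refine Finset.sum_subset (Finset.subset_univ _) fun v _ hv => ?_
    refine Finset.card_eq_zero.mpr (Finset.filter_eq_empty_iff.mpr fun t ht hvt => hv ?_)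
    have hc : 0 < (t.erase v).card := by
      rw [Finset.card_erase_of_mem hvt, (h.clique t ht).card_eq]
      norm_num
    obtain ⟨w, hw⟩ := Finset.card_pos.mp hc
    obtain ⟨hwv, hwt⟩ := Finset.mem_erase.mp hw
    exact (Set.Finite.mem_toFinset _).mpr ⟨w, h.adj_of_mem ht hvt hwt hwv.symm⟩
  rw [h2] at h4
  rw [h3] at h5
  simp only [charge, Finset.sum_add_distrib, Finset.sum_sub_distrib, ← Finset.mul_sum,
    Finset.sum_const, ← Nat.cast_sum, h4, h5]
  rw [← Set.ncard_eq_toFinset_card]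
  push_cast
  simp only [nsmul_eq_mul]
  omega

theorem min_three_ncard_image_le {V : Type} [Finite V] {φ : V → ℕ} {A B : Set V} {x : V}
    (hAB : A ⊆ B) (hBA : B ⊆ insert x A) (h : min 3 B.ncard ≤ (φ '' B).ncard) :
    min 3 (A.ncard + 1) ≤ (φ '' A).ncard + 1 := by
  by_cases hx : x ∈ B ∧ x ∉ A
  · have hB : B = insert x A := hBA.antisymm (Set.insert_subset hx.1 hAB)
    rw [hB, Set.ncard_insert_of_notMem hx.2 (Set.toFinite _), Set.image_insert_eq] at h
    exact h.trans (Set.ncard_insert_le _ _)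
  · have hB : B = A := by
      refine Set.Subset.antisymm (fun y hy => ?_) hAB
      rcases hBA hy with rfl | h'
      · exact not_not.mp fun hn => hx ⟨hy, hn⟩
      · exact h'
    rw [hB] at h
    omega

/-- Recoloring the contracted vertex: a 3-dynamic coloring of the contraction extends to the
whole graph if at most five colors have to be avoided at the contracted vertex. -/
theorem IsDynColoring.exists_update {V : Type} [Fintype V] [DecidableEq V] {G : SimpleGraph V}
    {v p : V} {φ : V → ℕ} (hφ : IsDynColoring (contractGraph G v p) 3 φ) (hvp : G.Adj v p)
    (hdeg : min 3 (G.neighborSet v).ncard ≤ (φ '' G.neighborSet v).ncard)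
    (hp : min 3 (G.neighborSet p).ncard ≤ (φ '' (G.neighborSet p \ {v})).ncard + 1)
    {F : Finset ℕ} (hF : F.card ≤ 5) (hN : ∀ u, G.Adj v u → φ u ∈ F)
    (hS : ∀ u, G.Adj v u → (φ '' (G.neighborSet u \ {v})).ncard ≤ 2 →
      φ '' (G.neighborSet u \ {v}) ⊆ F)
    {S : Finset ℕ} (hSc : 6 ≤ S.card) :
    ∃ γ ∈ S, IsDynColoring G 3 (Function.update φ v γ) := by
  obtain ⟨γ, hγS, hγF⟩ := Finset.exists_mem_notMem_of_card_lt_card (show F.card < S.card by omega)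
  have hn : ∀ x, x ≠ v → Function.update φ v γ x = φ x := fun x hx => Function.update_of_ne hx ..
  have hv : Function.update φ v γ v = γ := Function.update_self ..
  have himg : ∀ A : Set V, v ∉ A → Function.update φ v γ '' A = φ '' A := fun A hA =>
    Set.image_congr fun x hx => hn x (ne_of_mem_of_not_mem hx hA)
  refine ⟨γ, hγS, ?_, ?_⟩
  · intro x y hxy
    by_cases hx : x = v
    · subst hx
      rw [hv, hn y hxy.ne']
      exact fun e => hγF (e ▸ hN y hxy)
    by_cases hy : y = v
    · subst hy
      rw [hv, hn x hx]
      exact fun e => hγF (e ▸ hN x hxy.symm)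
    rw [hn x hx, hn y hy]
    exact hφ.1 ⟨hx, hy, hxy.ne, Or.inl hxy⟩
  · intro u
    by_cases huv : u = v
    · rwa [huv, himg _ (fun h => h.ne rfl)]
    by_cases hu : G.Adj v u
    · have hmem : v ∈ G.neighborSet u := hu.symm
      have hins : G.neighborSet u = insert v (G.neighborSet u \ {v}) :=
        (Set.insert_sdiff_self_of_mem hmem).symm
      have hcard : (G.neighborSet u).ncard = (G.neighborSet u \ {v}).ncard + 1 :=
        (Set.ncard_sdiff_singleton_add_one hmem (Set.toFinite _)).symm
      have hmain : min 3 (G.neighborSet u).ncard ≤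
          (φ '' (G.neighborSet u \ {v})).ncard + 1 := by
        by_cases hup : u = p
        · rwa [hup]
        rw [hcard]
        refine min_three_ncard_image_le (x := p) ?_ ?_ (hφ.2 u)
        · exact fun x hx => ⟨huv, hx.2, hx.1.ne, Or.inl hx.1⟩
        · rintro x ⟨-, hxv, -, hx | ⟨h, -⟩ | ⟨h, -⟩⟩
          · exact Or.inr ⟨hx, hxv⟩
          · exact absurd h hup
          · exact Or.inl h
      have himg' : Function.update φ v γ '' G.neighborSet u =
          insert γ (φ '' (G.neighborSet u \ {v})) := by
        conv_lhs => rw [hins, Set.image_insert_eq, hv, himg _ (fun h => h.2 rfl)]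
      rw [himg']
      by_cases h2 : (φ '' (G.neighborSet u \ {v})).ncard ≤ 2
      · rwa [Set.ncard_insert_of_notMem (fun h => hγF (hS u hu h2 h)) (Set.toFinite _)]
      · exact (min_le_left _ _).trans ((not_le.mp h2).trans_le
          (Set.ncard_le_ncard (Set.subset_insert _ _) (Set.toFinite _)))
    · have hnb : (contractGraph G v p).neighborSet u = G.neighborSet u := by
        ext x
        refine ⟨?_, fun hx => ⟨huv, ?_, hx.ne, Or.inl hx⟩⟩
        · rintro ⟨-, hxv, -, hx | ⟨rfl, -⟩ | ⟨-, h⟩⟩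
          · exact hx
          · exact absurd hvp hu
          · exact absurd h hu
        · rintro rfl
          exact hu hx.symm
      rw [himg _ (fun h => hu h.symm), ← hnb]
      exact hφ.2 u

theorem min_three_ncard_neighborSet_le {V : Type} [Fintype V] [DecidableEq V] {G : SimpleGraph V}
    {v p : V} {φ : V → ℕ} (hφ : IsDynColoring (contractGraph G v p) 3 φ) (hvp : G.Adj v p) {c : V}
    (h : ∀ x, G.Adj v x → x ≠ p → x ≠ c → G.Adj p x) :
    min 3 (G.neighborSet p).ncard ≤ (φ '' (G.neighborSet p \ {v})).ncard + 1 := by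
  have hcard : (G.neighborSet p).ncard = (G.neighborSet p \ {v}).ncard + 1 :=
    (Set.ncard_sdiff_singleton_add_one (s := G.neighborSet p) hvp.symm (Set.toFinite _)).symm
  rw [hcard]
  refine min_three_ncard_image_le (x := c) ?_ ?_ (hφ.2 p)
  · exact fun x hx => ⟨hvp.ne', hx.2, hx.1.ne, Or.inl hx.1⟩
  · rintro x ⟨-, hxv, hpx, hx | ⟨-, hx⟩ | ⟨h, -⟩⟩
    · exact Or.inr ⟨hx, hxv⟩
    · by_cases hxc : x = c
      · exact Or.inl hxc
      · exact Or.inr ⟨h x hx hpx.symm hxc, hxv⟩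
    · exact absurd h.symm hpx

theorem Set.exists_subset_pair_of_ncard_le_two {α : Type*} {s : Set α} (hs : s.Finite)
    (h : s.ncard ≤ 2) {a : α} (ha : a ∈ s) : ∃ w, s ⊆ {a, w} := by
  have h1 : (s \ {a}).ncard ≤ 1 := by
    have := Set.ncard_sdiff_singleton_add_one ha hs
    omega
  rw [Set.ncard_le_one_iff_eq (hs.subset Set.sdiff_subset)] at h1
  rcases h1 with h1 | ⟨w, h1⟩
  · exact ⟨a, fun x hx => by
      by_contra hn
      exact (h1 ▸ (⟨hx, fun e => hn (Or.inl e)⟩ : x ∈ s \ {a}) : x ∈ (∅ : Set α))⟩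
  · refine ⟨w, fun x hx => ?_⟩
    by_cases hxa : x = a
    · exact Or.inl hxa
    · exact Or.inr (h1 ▸ (⟨hx, hxa⟩ : x ∈ s \ {a}) : x ∈ ({w} : Set α))

theorem Set.eq_pair_of_ncard_le_two {α : Type*} {s : Set α} (hs : s.Finite)
    (h : s.ncard ≤ 2) {a b : α} (ha : a ∈ s) (hb : b ∈ s) (hab : a ≠ b) : s = {a, b} := by
  refine (Set.eq_of_subset_of_ncard_le ?_ ?_ hs).symm
  · rintro x (rfl | rfl)
    exacts [ha, hb]
  · rwa [Set.ncard_pair hab]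

/-- A vertex whose neighbors see the color of some other vertex sees, if it sees at most two
colors, only that color and one further color, which is the color of any other visible vertex of
a different color. -/
theorem exists_color_bound {V : Type} [Finite V] (φ : V → ℕ) {A : Set V} {x : V} (hx : x ∈ A) :
    ∃ w, (φ '' A).ncard ≤ 2 → ∀ c ∈ φ '' A, (c = φ x ∨ c = w) ∧
      ∀ y ∈ A, φ y ≠ φ x → c = φ x ∨ c = φ y := by
  by_cases h : (φ '' A).ncard ≤ 2
  · obtain ⟨w, hw⟩ := Set.exists_subset_pair_of_ncard_le_two (Set.toFinite _) h
      (Set.mem_image_of_mem φ hx)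
    refine ⟨w, fun _ c hc => ⟨hw hc, fun y hy hne => ?_⟩⟩
    rw [Set.eq_pair_of_ncard_le_two (Set.toFinite _) h (Set.mem_image_of_mem φ hx)
      (Set.mem_image_of_mem φ hy) hne.symm] at hc
    exact hc
  · exact ⟨0, fun h' => absurd h' h⟩

theorem min_three_ncard_le_ncard_image {V : Type} [Finite V] {φ : V → ℕ} {A : Set V} {x y z : V}
    (hx : x ∈ A) (hy : y ∈ A) (hz : z ∈ A) (hxy : φ x ≠ φ y) (hyz : φ y ≠ φ z) (hxz : φ x ≠ φ z) :
    min 3 A.ncard ≤ (φ '' A).ncard := by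
  refine (min_le_left _ _).trans ?_
  exact (Set.two_lt_ncard_iff (Set.toFinite _)).mpr ⟨φ x, φ y, φ z, Set.mem_image_of_mem φ hx,
    Set.mem_image_of_mem φ hy, Set.mem_image_of_mem φ hz, hxy, hxz, hyz⟩

/-- Contracting the edge `vp` is a reduction: every 3-dynamic coloring of the contraction can be
extended by choosing the color of `v` from a list of six colors. -/
def IsReducible {V : Type} [DecidableEq V] (G : SimpleGraph V) (v p : V) : Prop :=
  ∀ φ : V → ℕ, IsDynColoring (contractGraph G v p) 3 φ →
    ∀ S : Finset ℕ, 6 ≤ S.card → ∃ γ ∈ S, IsDynColoring G 3 (Function.update φ v γ)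

theorem isReducible_of_neighborSet_eq_one {V : Type} [Fintype V] [DecidableEq V]
    {G : SimpleGraph V} {v a : V} (hN : ∀ x, G.Adj v x ↔ x = a) : IsReducible G v a := by
  intro φ hφ S hS
  have hva := (hN a).mpr rfl
  have hp := min_three_ncard_neighborSet_le hφ hva (c := a) fun x hx hxa => absurd ((hN x).mp hx) hxa
  have hNs : G.neighborSet v = {a} := Set.ext hN
  have hdeg : min 3 (G.neighborSet v).ncard ≤ (φ '' G.neighborSet v).ncard := by
    simp [hNs]
  rcases (G.neighborSet a \ {v}).eq_empty_or_nonempty with h0 | ⟨x, hx⟩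
  · refine hφ.exists_update hva hdeg hp (F := {φ a}) (by simp) ?_ ?_ hS
    · simp [hN]
    · intro u hu
      rw [(hN u).mp hu, h0]
      simp
  · obtain ⟨w, hw⟩ := exists_color_bound φ hx
    refine hφ.exists_update hva hdeg hp (F := {φ a, φ x, w})
      (Finset.card_le_three.trans (by norm_num)) ?_ ?_ hS
    · simp [hN]
    · intro u hu h2 c hc
      rw [(hN u).mp hu] at h2 hc
      have := (hw h2 c hc).1
      simp only [Finset.coe_insert, Finset.coe_singleton, Set.mem_insert_iff, Set.mem_singleton_iff]
      tauto

theorem isReducible_of_neighborSet_eq_two {V : Type} [Fintype V] [DecidableEq V]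
    {G : SimpleGraph V} {v a b : V} (hN : ∀ x, G.Adj v x ↔ x = a ∨ x = b) (hab : G.Adj a b) :
    IsReducible G v a := by
  intro φ hφ S hS
  have hva := (hN a).mpr (Or.inl rfl)
  have hvb := (hN b).mpr (Or.inr rfl)
  have hp := min_three_ncard_neighborSet_le hφ hva (c := b) fun x hx hxa hxb =>
    absurd ((hN x).mp hx) (by tauto)
  have hne : φ a ≠ φ b := hφ.1 ⟨hva.ne', hvb.ne', hab.ne, Or.inl hab⟩
  have hNs : G.neighborSet v = {a, b} := Set.ext hN
  have hdeg : min 3 (G.neighborSet v).ncard ≤ (φ '' G.neighborSet v).ncard := by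
    simp [hNs, Set.image_pair, Set.ncard_pair hne, Set.ncard_pair hab.ne]
  obtain ⟨wa, hwa⟩ := exists_color_bound φ (A := G.neighborSet a \ {v}) ⟨hab, hvb.ne'⟩
  obtain ⟨wb, hwb⟩ := exists_color_bound φ (A := G.neighborSet b \ {v}) ⟨hab.symm, hva.ne'⟩
  refine hφ.exists_update hva hdeg hp (F := {φ a, φ b, wa, wb})
    (Finset.card_le_four.trans (by norm_num)) ?_ ?_ hS
  · intro u hu
    rcases (hN u).mp hu with rfl | rfl <;> simp
  · intro u hu h2 c hc
    simp only [Finset.coe_insert, Finset.coe_singleton, Set.mem_insert_iff, Set.mem_singleton_iff]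
    rcases (hN u).mp hu with rfl | rfl
    · have := (hwa h2 c hc).1
      tauto
    · have := (hwb h2 c hc).1
      tauto

theorem isReducible_of_neighborSet_eq_three {V : Type} [Fintype V] [DecidableEq V]
    {G : SimpleGraph V} {v a b c p : V} (hN : ∀ x, G.Adj v x ↔ x = a ∨ x = b ∨ x = c)
    (hab : G.Adj a b) (hbc : G.Adj b c) (hvp : G.Adj v p) (hac : (contractGraph G v p).Adj a c)
    (hpa : ∃ y, ∀ x, G.Adj v x → x ≠ p → x ≠ y → G.Adj p x) :
    IsReducible G v p := by
  intro φ hφ S hS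
  have hva := (hN a).mpr (by simp)
  have hvb := (hN b).mpr (by simp)
  have hvc := (hN c).mpr (by simp)
  obtain ⟨y, hy⟩ := hpa
  have hp := min_three_ncard_neighborSet_le hφ hvp hy
  have h1 : φ a ≠ φ b := hφ.1 ⟨hva.ne', hvb.ne', hab.ne, Or.inl hab⟩
  have h2 : φ b ≠ φ c := hφ.1 ⟨hvb.ne', hvc.ne', hbc.ne, Or.inl hbc⟩
  have h3 : φ a ≠ φ c := hφ.1 hac
  have hdeg : min 3 (G.neighborSet v).ncard ≤ (φ '' G.neighborSet v).ncard :=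
    min_three_ncard_le_ncard_image hva hvb hvc h1 h2 h3
  obtain ⟨wa, hwa⟩ := exists_color_bound φ (A := G.neighborSet a \ {v}) ⟨hab, hvb.ne'⟩
  obtain ⟨wb, hwb⟩ := exists_color_bound φ (A := G.neighborSet b \ {v}) ⟨hab.symm, hva.ne'⟩
  obtain ⟨wc, hwc⟩ := exists_color_bound φ (A := G.neighborSet c \ {v}) ⟨hbc.symm, hvb.ne'⟩
  refine hφ.exists_update hvp hdeg hp (F := {φ a, φ b, φ c, wa, wc})
    Finset.card_le_five ?_ ?_ hS
  · intro u hu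
    rcases (hN u).mp hu with rfl | rfl | rfl <;> simp
  · intro u hu h2' k hk
    simp only [Finset.coe_insert, Finset.coe_singleton, Set.mem_insert_iff, Set.mem_singleton_iff]
    rcases (hN u).mp hu with rfl | rfl | rfl
    · have := (hwa h2' k hk).1
      tauto
    · have := (hwb h2' k hk).2 c ⟨hbc, hvc.ne'⟩ h3.symm
      tauto
    · have := (hwc h2' k hk).1
      tauto

theorem isReducible_of_neighborSet_eq_four {V : Type} [Fintype V] [DecidableEq V]
    {G : SimpleGraph V} {v a b c d : V} (hN : ∀ x, G.Adj v x ↔ x = a ∨ x = b ∨ x = c ∨ x = d)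
    (hab : G.Adj a b) (hbc : G.Adj b c) (hcd : G.Adj c d) (hda : G.Adj d a) (hac : a ≠ c) :
    IsReducible G v a := by
  intro φ hφ S hS
  have hva := (hN a).mpr (by simp)
  have hvb := (hN b).mpr (by simp)
  have hvc := (hN c).mpr (by simp)
  have hvd := (hN d).mpr (by simp)
  have hp := min_three_ncard_neighborSet_le hφ hva (c := c) fun x hx hxa hxc => by
    rcases (hN x).mp hx with rfl | rfl | rfl | rfl
    exacts [absurd rfl hxa, hab, absurd rfl hxc, hda.symm]
  have h1 : φ a ≠ φ b := hφ.1 ⟨hva.ne', hvb.ne', hab.ne, Or.inl hab⟩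
  have h2 : φ b ≠ φ c := hφ.1 ⟨hvb.ne', hvc.ne', hbc.ne, Or.inl hbc⟩
  have h3 : φ a ≠ φ c := hφ.1 ⟨hva.ne', hvc.ne', hac, Or.inr (Or.inl ⟨rfl, hvc⟩)⟩
  have hdeg : min 3 (G.neighborSet v).ncard ≤ (φ '' G.neighborSet v).ncard :=
    min_three_ncard_le_ncard_image hva hvb hvc h1 h2 h3
  obtain ⟨wa, hwa⟩ := exists_color_bound φ (A := G.neighborSet a \ {v}) ⟨hab, hvb.ne'⟩
  obtain ⟨wb, hwb⟩ := exists_color_bound φ (A := G.neighborSet b \ {v}) ⟨hab.symm, hva.ne'⟩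
  obtain ⟨wc, hwc⟩ := exists_color_bound φ (A := G.neighborSet c \ {v}) ⟨hbc.symm, hvb.ne'⟩
  obtain ⟨wd, hwd⟩ := exists_color_bound φ (A := G.neighborSet d \ {v}) ⟨hda, hva.ne'⟩
  have key : ∀ F : Finset ℕ, F.card ≤ 5 → φ a ∈ F → φ b ∈ F → φ c ∈ F → φ d ∈ F →
      (φ d = φ b → wa ∈ F ∧ wc ∈ F) → ∃ γ ∈ S, IsDynColoring G 3 (Function.update φ v γ) := by
    intro F hF ha hb hc hd hw
    refine hφ.exists_update hva hdeg hp hF ?_ ?_ hS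
    · intro u hu
      rcases (hN u).mp hu with rfl | rfl | rfl | rfl <;> assumption
    · intro u hu h2' k hk
      rcases (hN u).mp hu with rfl | rfl | rfl | rfl
      · obtain ⟨h4, h5⟩ := hwa h2' k hk
        have := h5 d ⟨hda.symm, hvd.ne'⟩
        grind
      · have := (hwb h2' k hk).2 c ⟨hbc, hvc.ne'⟩ h3.symm
        grind
      · obtain ⟨h4, h5⟩ := hwc h2' k hk
        have := h5 d ⟨hcd, hvd.ne'⟩
        grind
      · have := (hwd h2' k hk).2 c ⟨hcd.symm, hvc.ne'⟩ h3.symm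
        grind
  by_cases h4 : φ d = φ b
  · exact key {φ a, φ b, φ c, wa, wc} Finset.card_le_five (by simp) (by simp) (by simp)
      (by simp [h4]) (by simp)
  · exact key {φ a, φ b, φ c, φ d} (Finset.card_le_four.trans (by norm_num)) (by simp) (by simp)
      (by simp) (by simp) (fun h => absurd h h4)

/-- In a proper coloring of a 5-cycle, every pair of equally colored vertices frees one of five
slots for the forbidden color at their common neighbor. -/
theorem exists_forbidden_of_five_cycle {a b c d e : ℕ} (wa wb wc wd we : ℕ) (hab : a ≠ b)
    (hbc : b ≠ c) (hcd : c ≠ d) (hde : d ≠ e) (hea : e ≠ a) :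
    ∃ F : Finset ℕ, F.card ≤ 5 ∧ (a ∈ F ∧ b ∈ F ∧ c ∈ F ∧ d ∈ F ∧ e ∈ F) ∧ (e = b → wa ∈ F) ∧
      (a = c → wb ∈ F) ∧ (b = d → wc ∈ F) ∧ (c = e → wd ∈ F) ∧ (d = a → we ∈ F) := by
  refine ⟨{if d = a then we else a, if e = b then wa else b, if a = c then wb else c,
    if b = d then wc else d, if c = e then wd else e}, Finset.card_le_five, ?_⟩
  simp only [Finset.mem_insert, Finset.mem_singleton]
  refine ⟨⟨?_, ?_, ?_, ?_, ?_⟩, ?_, ?_, ?_, ?_, ?_⟩ <;> grind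

theorem isReducible_of_neighborSet_eq_five {V : Type} [Fintype V] [DecidableEq V]
    {G : SimpleGraph V} {v a b c d e p x y : V}
    (hN : ∀ x, G.Adj v x ↔ x = a ∨ x = b ∨ x = c ∨ x = d ∨ x = e)
    (hab : G.Adj a b) (hbc : G.Adj b c) (hcd : G.Adj c d) (hde : G.Adj d e) (hea : G.Adj e a)
    (hvp : G.Adj v p) (hpx : G.Adj p x) (hpy : G.Adj p y) (hxv : x ≠ v) (hyv : y ≠ v)
    (hxy : G.Adj x y) : IsReducible G v p := by
  intro φ hφ S hS
  have hva := (hN a).mpr (by simp)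
  have hvb := (hN b).mpr (by simp)
  have hvc := (hN c).mpr (by simp)
  have hvd := (hN d).mpr (by simp)
  have hve := (hN e).mpr (by simp)
  have hpr : ∀ {x y}, x ≠ v → y ≠ v → G.Adj x y → φ x ≠ φ y := fun hx hy h =>
    hφ.1 ⟨hx, hy, h.ne, Or.inl h⟩
  have hp : min 3 (G.neighborSet p).ncard ≤ (φ '' (G.neighborSet p \ {v})).ncard + 1 := by
    refine (min_le_left _ _).trans (Nat.succ_le_succ ?_)
    rw [← Set.ncard_pair (hpr hxv hyv hxy), ← Set.image_pair]
    refine Set.ncard_le_ncard (Set.image_mono ?_) (Set.toFinite _)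
    rintro z (rfl | rfl)
    exacts [⟨hpx, hxv⟩, ⟨hpy, hyv⟩]
  have h1 := hpr hva.ne' hvb.ne' hab
  have h2 := hpr hvb.ne' hvc.ne' hbc
  have h3 := hpr hvc.ne' hvd.ne' hcd
  have h4 := hpr hvd.ne' hve.ne' hde
  have h5 := hpr hve.ne' hva.ne' hea
  have hdeg : min 3 (G.neighborSet v).ncard ≤ (φ '' G.neighborSet v).ncard := by
    by_cases hac : φ a = φ c
    · exact min_three_ncard_le_ncard_image hvd hve hva h4 h5 (hac ▸ h3.symm)
    · exact min_three_ncard_le_ncard_image hva hvb hvc h1 h2 hac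
  obtain ⟨wa, hwa⟩ := exists_color_bound φ (A := G.neighborSet a \ {v}) ⟨hab, hvb.ne'⟩
  obtain ⟨wb, hwb⟩ := exists_color_bound φ (A := G.neighborSet b \ {v}) ⟨hbc, hvc.ne'⟩
  obtain ⟨wc, hwc⟩ := exists_color_bound φ (A := G.neighborSet c \ {v}) ⟨hcd, hvd.ne'⟩
  obtain ⟨wd, hwd⟩ := exists_color_bound φ (A := G.neighborSet d \ {v}) ⟨hde, hve.ne'⟩
  obtain ⟨we, hwe⟩ := exists_color_bound φ (A := G.neighborSet e \ {v}) ⟨hea, hva.ne'⟩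
  obtain ⟨F, hF, ⟨ha, hb, hc, hd, he⟩, hFa, hFb, hFc, hFd, hFe⟩ :=
    exists_forbidden_of_five_cycle wa wb wc wd we h1 h2 h3 h4 h5
  refine hφ.exists_update hvp hdeg hp hF ?_ ?_ hS
  · intro u hu
    rcases (hN u).mp hu with rfl | rfl | rfl | rfl | rfl <;> assumption
  · have close : ∀ {k i j w : ℕ}, (i ∈ F) → (j ∈ F) → (i = j → w ∈ F) → (k = j ∨ k = w) →
        (i ≠ j → k = j ∨ k = i) → k ∈ F := by
      intro k i j w hi hj hw h h'
      by_cases hij : i = j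
      · rcases h with rfl | rfl
        exacts [hj, hw hij]
      · rcases h' hij with rfl | rfl
        exacts [hj, hi]
    intro u hu h2' k hk
    rcases (hN u).mp hu with rfl | rfl | rfl | rfl | rfl
    · obtain ⟨h6, h7⟩ := hwa h2' k hk
      exact close he hb hFa h6 (h7 e ⟨hea.symm, hve.ne'⟩)
    · obtain ⟨h6, h7⟩ := hwb h2' k hk
      exact close ha hc hFb h6 (h7 a ⟨hab.symm, hva.ne'⟩)
    · obtain ⟨h6, h7⟩ := hwc h2' k hk
      exact close hb hd hFc h6 (h7 b ⟨hbc.symm, hvb.ne'⟩)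
    · obtain ⟨h6, h7⟩ := hwd h2' k hk
      exact close hc he hFd h6 (h7 c ⟨hcd.symm, hvc.ne'⟩)
    · obtain ⟨h6, h7⟩ := hwe h2' k hk
      exact close hd ha hFe h6 (h7 d ⟨hde.symm, hvd.ne'⟩)

/-- Some edge at `v` can be contracted within the class of acyclic complexes, and every
3-dynamic coloring of the contraction extends to `v`. -/
def HasReduction {V : Type} [DecidableEq V] (G : SimpleGraph V) (T : Finset (Finset V))
    (v : V) : Prop :=
  ∃ p, G.Adj v p ∧ (∀ x, G.Adj v x → G.Adj p x → {v, p, x} ∈ T) ∧ IsReducible G v p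

theorem IsAcyclicComplex.adj_of_triple {V : Type} [DecidableEq V] {G : SimpleGraph V}
    {T : Finset (Finset V)} (h : IsAcyclicComplex G T) {x y z : V} (ht : {x, y, z} ∈ T) :
    G.Adj x y ∧ G.Adj y z ∧ G.Adj x z := by
  obtain ⟨hxy, hyz, hxz⟩ := h.ne_of_mem ht
  exact ⟨h.adj_of_mem ht (by simp) (by simp) hxy, h.adj_of_mem ht (by simp) (by simp) hyz,
    h.adj_of_mem ht (by simp) (by simp) hxz⟩

theorem IsAcyclicComplex.exists_link_pair {V : Type} [DecidableEq V] {G : SimpleGraph V}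
    {T : Finset (Finset V)} (h : IsAcyclicComplex G T) {v x : V} (hvx : v ≠ x)
    (h2 : (T.filter fun t => v ∈ t ∧ x ∈ t).card = 2) :
    ∃ y z, y ≠ z ∧ {v, x, y} ∈ T ∧ {v, x, z} ∈ T ∧ ∀ w, {v, x, w} ∈ T → w = y ∨ w = z := by
  obtain ⟨s, t, hst, heq⟩ := Finset.card_eq_two.mp h2
  have hs : s ∈ T.filter fun t => v ∈ t ∧ x ∈ t := by simp [heq]
  have ht : t ∈ T.filter fun t => v ∈ t ∧ x ∈ t := by simp [heq]
  obtain ⟨hsT, hs1, hs2⟩ := Finset.mem_filter.mp hs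
  obtain ⟨htT, ht1, ht2⟩ := Finset.mem_filter.mp ht
  obtain ⟨y, hyv, hyx, rfl⟩ := h.exists_third hsT hs1 hs2 hvx
  obtain ⟨z, hzv, hzx, rfl⟩ := h.exists_third htT ht1 ht2 hvx
  refine ⟨y, z, fun e => hst (e ▸ rfl), hsT, htT, fun w hw => ?_⟩
  obtain ⟨-, hxw, hvw⟩ := h.ne_of_mem hw
  have hm : ({v, x, w} : Finset V) ∈ T.filter fun t => v ∈ t ∧ x ∈ t := by simp [hw]
  rw [heq, Finset.mem_insert, Finset.mem_singleton] at hm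
  have hw' : w ∈ ({v, x, w} : Finset V) := by simp
  rcases hm with e | e <;> rw [e] at hw' <;>
    simp only [Finset.mem_insert, Finset.mem_singleton] at hw'
  · exact Or.inl (hw'.resolve_left hvw.symm |>.resolve_left hxw.symm)
  · exact Or.inr (hw'.resolve_left hvw.symm |>.resolve_left hxw.symm)

theorem hasReduction_of_path {V : Type} [Fintype V] [DecidableEq V] {G : SimpleGraph V}
    {T : Finset (Finset V)} (h : IsAcyclicComplex G T) {v a b c : V}
    (hN : ∀ x, G.Adj v x ↔ x = a ∨ x = b ∨ x = c) (hab : {v, a, b} ∈ T) (hbc : {v, b, c} ∈ T)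
    (hne : a ≠ c) : HasReduction G T v := by
  obtain ⟨hva, ab, hvb⟩ := h.adj_of_triple hab
  obtain ⟨-, bc, hvc⟩ := h.adj_of_triple hbc
  by_cases ac : G.Adj a c
  · refine ⟨b, hvb, fun x hx hbx => ?_, isReducible_of_neighborSet_eq_three hN ab bc hvb
      ⟨hva.ne', hvc.ne', hne, Or.inl ac⟩ ⟨a, fun x hx hxb hxa => ?_⟩⟩
    · rcases (hN x).mp hx with rfl | rfl | rfl
      · rwa [Finset.pair_comm]
      · exact absurd rfl hbx.ne
      · exact hbc
    · rcases (hN x).mp hx with rfl | rfl | rfl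
      exacts [absurd rfl hxa, absurd rfl hxb, bc]
  · refine ⟨a, hva, fun x hx hax => ?_, isReducible_of_neighborSet_eq_three hN ab bc hva
      ⟨hva.ne', hvc.ne', hne, Or.inr (Or.inl ⟨rfl, hvc⟩)⟩ ⟨c, fun x hx hxa hxc => ?_⟩⟩
    · rcases (hN x).mp hx with rfl | rfl | rfl
      exacts [absurd rfl hax.ne, hab, absurd hax ac]
    · rcases (hN x).mp hx with rfl | rfl | rfl
      exacts [absurd rfl hxa, ab, absurd rfl hxc]

theorem hasReduction_of_four_cycle {V : Type} [Fintype V] [DecidableEq V] {G : SimpleGraph V}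
    {T : Finset (Finset V)} (h : IsAcyclicComplex G T) {v a b c d : V}
    (hN : ∀ x, G.Adj v x ↔ x = a ∨ x = b ∨ x = c ∨ x = d) (hab : {v, a, b} ∈ T)
    (hbc : {v, b, c} ∈ T) (hcd : {v, c, d} ∈ T) (hda : {v, d, a} ∈ T) (hac : a ≠ c)
    (hbd : b ≠ d) : HasReduction G T v := by
  have main : ∀ {a b c d : V}, (∀ x, G.Adj v x ↔ x = a ∨ x = b ∨ x = c ∨ x = d) →
      {v, a, b} ∈ T → {v, b, c} ∈ T → {v, c, d} ∈ T → {v, d, a} ∈ T → a ≠ c →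
      ¬ G.Adj a c → HasReduction G T v := by
    intro a b c d hN hab hbc hcd hda hac hn
    obtain ⟨hva, ab, hvb⟩ := h.adj_of_triple hab
    refine ⟨a, hva, fun x hx hax => ?_, isReducible_of_neighborSet_eq_four hN ab
      (h.adj_of_triple hbc).2.1 (h.adj_of_triple hcd).2.1 (h.adj_of_triple hda).2.1 hac⟩
    rcases (hN x).mp hx with rfl | rfl | rfl | rfl
    · exact absurd rfl hax.ne
    · exact hab
    · exact absurd hax hn
    · rwa [Finset.pair_comm]
  by_cases ac : G.Adj a c
  · refine main (fun x => (hN x).trans (by tauto)) hbc hcd hda hab hbd fun bd => ?_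
    obtain ⟨-, cd, hvd⟩ := h.adj_of_triple hcd
    obtain ⟨-, da, -⟩ := h.adj_of_triple hda
    exact h.not_adj_of_common_neighbor hab hbc hac da.ne cd.ne' hvd bd.symm ac
  · exact main hN hab hbc hcd hda hac ac

theorem hasReduction_of_five_cycle_of_adj {V : Type} [Fintype V] [DecidableEq V]
    {G : SimpleGraph V} {T : Finset (Finset V)} (h : IsAcyclicComplex G T) {v a b c d e : V}
    (hN : ∀ x, G.Adj v x ↔ x = a ∨ x = b ∨ x = c ∨ x = d ∨ x = e) (hab : {v, a, b} ∈ T)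
    (hbc : {v, b, c} ∈ T) (hcd : {v, c, d} ∈ T) (hde : {v, d, e} ∈ T) (hea : {v, e, a} ∈ T)
    (hbd : b ≠ d) (had : a ≠ d) (hbe : b ≠ e) (hce : c ≠ e) (ac : G.Adj a c) :
    HasReduction G T v := by
  obtain ⟨hva, ab, hvb⟩ := h.adj_of_triple hab
  obtain ⟨hvc, cd, hvd⟩ := h.adj_of_triple hcd
  obtain ⟨-, bc, -⟩ := h.adj_of_triple hbc
  obtain ⟨-, de, -⟩ := h.adj_of_triple hde
  obtain ⟨-, ea, -⟩ := h.adj_of_triple hea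
  refine ⟨b, hvb, fun x hx hbx => ?_, isReducible_of_neighborSet_eq_five hN ab bc cd de ea hvb
    ab.symm bc hva.ne' hvc.ne' ac⟩
  rcases (hN x).mp hx with rfl | rfl | rfl | rfl | rfl
  · rwa [Finset.pair_comm]
  · exact absurd rfl hbx.ne
  · exact hbc
  · exact absurd hbx (h.not_adj_of_common_neighbor hbc hcd hbd ab.ne had hva ac)
  · rw [Finset.pair_comm] at hab hea
    exact absurd hbx (h.not_adj_of_common_neighbor hab hea hbe bc.ne' hce hvc ac.symm)

/-- A vertex of degree five whose neighbor `p` lies on two triangles only and has no edges in its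
neighborhood apart from those at the vertex: the only obstruction to the existence of a
reduction. -/
def IsBad {V : Type} [DecidableEq V] (G : SimpleGraph V) (T : Finset (Finset V)) (v p : V) :
    Prop :=
  G.Adj v p ∧ (T.filter fun t => v ∈ t ∧ p ∈ t).card = 2 ∧
    ∀ x y, G.Adj p x → G.Adj p y → x ≠ v → y ≠ v → ¬ G.Adj x y

theorem hasReduction_or_isBad_of_five_cycle {V : Type} [Fintype V] [DecidableEq V]
    {G : SimpleGraph V} {T : Finset (Finset V)} (h : IsAcyclicComplex G T) {v a b c d e : V}
    (hN : ∀ x, G.Adj v x ↔ x = a ∨ x = b ∨ x = c ∨ x = d ∨ x = e) (hab : {v, a, b} ∈ T)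
    (hbc : {v, b, c} ∈ T) (hcd : {v, c, d} ∈ T) (hde : {v, d, e} ∈ T) (hea : {v, e, a} ∈ T)
    (hac : a ≠ c) (hbd : b ≠ d) (had : a ≠ d) (hbe : b ≠ e) (hce : c ≠ e)
    (ha2 : (T.filter fun t => v ∈ t ∧ a ∈ t).card = 2) :
    HasReduction G T v ∨ IsBad G T v a := by
  by_cases ac : G.Adj a c
  · exact Or.inl (hasReduction_of_five_cycle_of_adj h hN hab hbc hcd hde hea hbd had hbe hce ac)
  by_cases bd : G.Adj b d
  · exact Or.inl (hasReduction_of_five_cycle_of_adj h (fun x => (hN x).trans (by tauto))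
      hbc hcd hde hea hab hce hbe hac.symm had.symm bd)
  by_cases ce : G.Adj c e
  · exact Or.inl (hasReduction_of_five_cycle_of_adj h (fun x => (hN x).trans (by tauto))
      hcd hde hea hab hbc had.symm hac.symm hbd.symm hbe.symm ce)
  by_cases da : G.Adj d a
  · exact Or.inl (hasReduction_of_five_cycle_of_adj h (fun x => (hN x).trans (by tauto))
      hde hea hab hbc hcd hbe.symm hbd.symm hce.symm hac da)
  by_cases eb : G.Adj e b
  · exact Or.inl (hasReduction_of_five_cycle_of_adj h (fun x => (hN x).trans (by tauto))
      hea hab hbc hcd hde hac hce.symm had hbd eb)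
  by_cases hx : ∃ x y, G.Adj a x ∧ G.Adj a y ∧ x ≠ v ∧ y ≠ v ∧ G.Adj x y
  · obtain ⟨x, y, hax, hay, hxv, hyv, hxy⟩ := hx
    have hva := (hN a).mpr (by simp)
    refine Or.inl ⟨a, hva, fun z hz haz => ?_, isReducible_of_neighborSet_eq_five hN
      (h.adj_of_triple hab).2.1 (h.adj_of_triple hbc).2.1 (h.adj_of_triple hcd).2.1
      (h.adj_of_triple hde).2.1 (h.adj_of_triple hea).2.1 hva hax hay hxv hyv hxy⟩
    rcases (hN z).mp hz with rfl | rfl | rfl | rfl | rfl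
    · exact absurd rfl haz.ne
    · exact hab
    · exact absurd haz ac
    · exact absurd haz.symm da
    · rwa [Finset.pair_comm]
  · push Not at hx
    exact Or.inr ⟨(hN a).mpr (by simp), ha2, fun x y hx1 hx2 hx3 hx4 => hx x y hx1 hx2 hx3 hx4⟩

/-- A 2-regular graph on four vertices is a 4-cycle. -/
theorem exists_four_cycle {V : Type} [DecidableEq V] {N : Finset V} {E : V → V → Prop}
    (hswap : ∀ {x y}, E x y → E y x) (hmem : ∀ {x y}, E x y → x ∈ N ∧ y ∈ N ∧ x ≠ y)
    (hpair : ∀ x ∈ N, ∃ y z, y ≠ z ∧ E x y ∧ E x z ∧ ∀ w, E x w → w = y ∨ w = z)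
    (h4 : N.card = 4) :
    ∃ a b c d, (∀ x, x ∈ N ↔ x = a ∨ x = b ∨ x = c ∨ x = d) ∧ E a b ∧ E b c ∧ E c d ∧ E d a ∧
      a ≠ c ∧ b ≠ d := by
  have hfill : ∀ s ⊆ N, N.card ≤ s.card → ∀ x, x ∈ N ↔ x ∈ s := fun s hs hsc x => by
    rw [Finset.eq_of_subset_of_card_le hs hsc]
  obtain ⟨a, haN⟩ := Finset.card_pos.mp (show 0 < N.card by omega)
  obtain ⟨b, d, hbd, hab, had, ha⟩ := hpair a haN
  obtain ⟨-, hbN, hab'⟩ := hmem hab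
  obtain ⟨-, hdN, had'⟩ := hmem had
  have hs3 : ({a, b, d} : Finset V).card = 3 :=
    Finset.card_eq_three.mpr ⟨a, b, d, hab', had', hbd, rfl⟩
  obtain ⟨c, hcN, hc⟩ := Finset.exists_mem_notMem_of_card_lt_card
    (show ({a, b, d} : Finset V).card < N.card by omega)
  have hN : ∀ x, x ∈ N ↔ x = c ∨ x = a ∨ x = b ∨ x = d := by
    simpa using hfill (insert c {a, b, d})
      (by simp [Finset.insert_subset_iff, haN, hbN, hcN, hdN])
      (by rw [h4, Finset.card_insert_of_notMem hc, hs3])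
  simp only [Finset.mem_insert, Finset.mem_singleton, not_or] at hc
  obtain ⟨y, z, hyz, hcy, hcz, -⟩ := hpair c hcN
  have hlink : ∀ w, E c w → w = b ∨ w = d := by
    intro w hw
    rcases (hN w).mp (hmem hw).2.1 with rfl | rfl | h' | h'
    · exact absurd rfl (hmem hw).2.2
    · rcases ha c (hswap hw) with h' | h'
      exacts [absurd h' hc.2.1, absurd h' hc.2.2]
    exacts [Or.inl h', Or.inr h']
  obtain ⟨hcb, hcd⟩ : E c b ∧ E c d := by
    rcases hlink y hcy with rfl | rfl <;> rcases hlink z hcz with rfl | rfl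
    exacts [absurd rfl hyz, ⟨hcy, hcz⟩, ⟨hcz, hcy⟩, absurd rfl hyz]
  exact ⟨a, b, c, d, fun x => (hN x).trans (by tauto), hab, hswap hcb, hcd, hswap had,
    Ne.symm hc.1, hbd⟩

/-- A 2-regular graph on five vertices is a 5-cycle. -/
theorem exists_five_cycle {V : Type} [DecidableEq V] {N : Finset V} {E : V → V → Prop}
    (hswap : ∀ {x y}, E x y → E y x) (hmem : ∀ {x y}, E x y → x ∈ N ∧ y ∈ N ∧ x ≠ y)
    (hpair : ∀ x ∈ N, ∃ y z, y ≠ z ∧ E x y ∧ E x z ∧ ∀ w, E x w → w = y ∨ w = z)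
    (h5 : N.card = 5) :
    ∃ a b c d e, (∀ x, x ∈ N ↔ x = a ∨ x = b ∨ x = c ∨ x = d ∨ x = e) ∧ E a b ∧ E b c ∧ E c d ∧
      E d e ∧ E e a ∧ a ≠ c ∧ b ≠ d ∧ a ≠ d ∧ b ≠ e ∧ c ≠ e := by
  have hfill : ∀ s ⊆ N, N.card ≤ s.card → ∀ x, x ∈ N ↔ x ∈ s := fun s hs hsc x => by
    rw [Finset.eq_of_subset_of_card_le hs hsc]
  obtain ⟨a, haN⟩ := Finset.card_pos.mp (show 0 < N.card by omega)
  obtain ⟨b, e, hbe, hab, hae, ha⟩ := hpair a haN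
  obtain ⟨-, hbN, hab'⟩ := hmem hab
  obtain ⟨-, heN, hae'⟩ := hmem hae
  have other : ∀ {x y : V}, E x y → ∃ z, z ≠ y ∧ E x z ∧
      ∀ w, E x w → w = y ∨ w = z := by
    intro x y hxy
    obtain ⟨y', z', hne, h1, h2, h3⟩ := hpair x (hmem hxy).1
    rcases h3 y hxy with rfl | rfl
    exacts [⟨z', hne.symm, h2, h3⟩, ⟨y', hne, h1, fun w hw => (h3 w hw).symm⟩]
  obtain ⟨c, hca, hbc, hb⟩ := other (hswap hab)
  obtain ⟨d, hda, hed, he⟩ := other (hswap hae)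
  obtain ⟨-, hcN, hbc'⟩ := hmem hbc
  obtain ⟨-, hdN, hed'⟩ := hmem hed
  have hs3 : ({a, b, e} : Finset V).card = 3 :=
    Finset.card_eq_three.mpr ⟨a, b, e, hab', hae', hbe, rfl⟩
  have hce : c ≠ e := by
    rintro rfl
    obtain ⟨x, hxN, hx⟩ := Finset.exists_mem_notMem_of_card_lt_card
      (show ({a, b, c} : Finset V).card < N.card by omega)
    obtain ⟨y, hyN, hy⟩ := Finset.exists_mem_notMem_of_card_lt_card
      (show (insert x {a, b, c} : Finset V).card < N.card by
        rw [Finset.card_insert_of_notMem hx]; omega)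
    have hN := hfill (insert y (insert x {a, b, c}))
      (by simp [Finset.insert_subset_iff, haN, hbN, hcN, hxN, hyN])
      (by rw [h5, Finset.card_insert_of_notMem hy, Finset.card_insert_of_notMem hx, hs3])
    simp only [Finset.mem_insert, Finset.mem_singleton, not_or] at hN hx hy
    obtain ⟨z, w, hzw, hxz, hxw, -⟩ := hpair x hxN
    have hlink : ∀ w, E x w → w = y := by
      intro w hw
      obtain ⟨-, hwN, hxw⟩ := hmem hw
      rcases (hN w).mp hwN with h' | rfl | rfl | rfl | rfl
      · exact h'
      · exact absurd rfl hxw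
      · have := ha x (hswap hw)
        tauto
      · have := hb x (hswap hw)
        tauto
      · have h1 := he x (hswap hw)
        have h2 := he b (hswap hbc)
        grind
    exact hzw ((hlink z hxz).trans (hlink w hxw).symm)
  have hc : c ∉ ({a, b, e} : Finset V) := by
    simp [hca, hbc'.symm, hce]
  obtain ⟨f, hfN, hf⟩ := Finset.exists_mem_notMem_of_card_lt_card
    (show (insert c {a, b, e} : Finset V).card < N.card by
      rw [Finset.card_insert_of_notMem hc]; omega)
  have hN := hfill (insert f (insert c {a, b, e}))
    (by simp [Finset.insert_subset_iff, haN, hbN, hcN, heN, hfN])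
    (by rw [h5, Finset.card_insert_of_notMem hf, Finset.card_insert_of_notMem hc, hs3])
  simp only [Finset.mem_insert, Finset.mem_singleton, not_or] at hN hf
  have hlink : ∀ w, E f w → w = c ∨ w = e := by
    intro w hw
    obtain ⟨-, hwN, hfw⟩ := hmem hw
    rcases (hN w).mp hwN with rfl | h' | rfl | rfl | h'
    · exact absurd rfl hfw
    · exact Or.inl h'
    · have := ha f (hswap hw)
      tauto
    · have := hb f (hswap hw)
      tauto
    · exact Or.inr h'
  obtain ⟨y, z, hyz, hfy, hfz, -⟩ := hpair f hfN
  obtain ⟨hfc, hfe⟩ : E f c ∧ E f e := by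
    rcases hlink y hfy with rfl | rfl <;> rcases hlink z hfz with rfl | rfl
    exacts [absurd rfl hyz, ⟨hfy, hfz⟩, ⟨hfz, hfy⟩, absurd rfl hyz]
  exact ⟨a, b, c, f, e, fun x => (hN x).trans (by tauto), hab, hbc, hswap hfc, hfe, hswap hae,
    hca.symm, Ne.symm hf.2.2.1, Ne.symm hf.2.1, hbe, hce⟩

/-- The local structure at a vertex of positive charge. -/
theorem IsAcyclicComplex.hasReduction_or_isBad {V : Type} [Fintype V] [DecidableEq V]
    {G : SimpleGraph V} {T : Finset (Finset V)} (h : IsAcyclicComplex G T) {v : V}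
    (hv : v ∈ G.support) (hc : 0 < charge G T v) :
    HasReduction G T v ∨
      ((G.neighborSet v).ncard = 5 ∧ charge G T v = 1 ∧ ∃ p, IsBad G T v p) := by
  let N := (Set.toFinite (G.neighborSet v)).toFinset
  have hNm : ∀ x, x ∈ N ↔ G.Adj v x := fun x => (Set.Finite.mem_toFinset _)
  have hcard : (G.neighborSet v).ncard = N.card := Set.ncard_eq_toFinset_card _ _
  have hsum : ∑ x ∈ N, (T.filter fun t => v ∈ t ∧ x ∈ t).card =
    2 * (T.filter fun t => v ∈ t).card := h.two_mul_card_triangles v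
  have hle : ∀ x ∈ N, (T.filter fun t => v ∈ t ∧ x ∈ t).card ≤ 2 := fun x hx =>
    h.edge_le v x ((hNm x).mp hx).ne
  have hsum_le : ∑ x ∈ N, (T.filter fun t => v ∈ t ∧ x ∈ t).card ≤ N.card * 2 :=
    Finset.sum_le_card_nsmul N _ 2 hle
  have hpos : 0 < N.card := by
    obtain ⟨w, hw⟩ := hv
    exact Finset.card_pos.mpr ⟨w, (hNm w).mpr hw⟩
  rw [charge, hcard] at hc ⊢
  have hswap : ∀ {x y : V}, {v, x, y} ∈ T → {v, y, x} ∈ T := fun {x y} hxy => by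
    rwa [Finset.pair_comm]
  have hmem : ∀ {x y : V}, {v, x, y} ∈ T → x ∈ N ∧ y ∈ N ∧ x ≠ y := fun {x y} hxy =>
    ⟨(hNm x).mpr (h.adj_of_triple hxy).1, (hNm y).mpr (h.adj_of_triple hxy).2.2,
      (h.adj_of_triple hxy).2.1.ne⟩
  have hall : N.card * 2 ≤ ∑ x ∈ N, (T.filter fun t => v ∈ t ∧ x ∈ t).card →
      ∀ x ∈ N, (T.filter fun t => v ∈ t ∧ x ∈ t).card = 2 := by
    intro hge
    refine (Finset.sum_eq_sum_iff_of_le hle).mp ?_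
    rw [Finset.sum_const, smul_eq_mul]
    exact le_antisymm hsum_le hge
  have hpair : ∀ x ∈ N, (T.filter fun t => v ∈ t ∧ x ∈ t).card = 2 → ∃ y z, y ≠ z ∧
      {v, x, y} ∈ T ∧ {v, x, z} ∈ T ∧ ∀ w, {v, x, w} ∈ T → w = y ∨ w = z := fun x hx h2 =>
    h.exists_link_pair ((hNm x).mp hx).ne h2
  have hfill : ∀ s ⊆ N, N.card ≤ s.card → ∀ x, G.Adj v x ↔ x ∈ s := fun s hs hsc x => by
    rw [Finset.eq_of_subset_of_card_le hs hsc, hNm]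
  have hdeg : N.card = 1 ∨ N.card = 2 ∨ N.card = 3 ∨ N.card = 4 ∨ N.card = 5 := by omega
  rcases hdeg with h1 | h2 | h3 | h4 | h5
  · obtain ⟨a, ha⟩ := Finset.card_eq_one.mp h1
    have hN : ∀ x, G.Adj v x ↔ x = a := fun x => by rw [← hNm, ha, Finset.mem_singleton]
    refine Or.inl ⟨a, (hN a).mpr rfl, fun x hx hax => ?_, isReducible_of_neighborSet_eq_one hN⟩
    exact absurd ((hN x).mp hx).symm hax.ne
  · have : 0 < (T.filter fun t => v ∈ t).card := by omega
    obtain ⟨t, ht⟩ := Finset.card_pos.mp this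
    obtain ⟨htT, hvt⟩ := Finset.mem_filter.mp ht
    have : 0 < (t.erase v).card := by
      rw [Finset.card_erase_of_mem hvt, (h.clique t htT).card_eq]
      norm_num
    obtain ⟨a, ha⟩ := Finset.card_pos.mp this
    obtain ⟨hav, hat⟩ := Finset.mem_erase.mp ha
    obtain ⟨b, -, -, rfl⟩ := h.exists_third htT hvt hat hav.symm
    obtain ⟨haN, hbN, hab⟩ := hmem htT
    have hN : ∀ x, G.Adj v x ↔ x = a ∨ x = b := by
      simpa using hfill {a, b} (by simp [Finset.insert_subset_iff, haN, hbN])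
        (by rw [h2, Finset.card_pair hab])
    obtain ⟨hva, ab, -⟩ := h.adj_of_triple htT
    refine Or.inl ⟨a, hva, fun x hx hax => ?_, isReducible_of_neighborSet_eq_two hN ab⟩
    rcases (hN x).mp hx with rfl | rfl
    exacts [absurd rfl hax.ne, htT]
  · obtain ⟨b, hbN, hb2⟩ : ∃ b ∈ N, 1 < (T.filter fun t => v ∈ t ∧ b ∈ t).card := by
      by_contra! hcon
      have := Finset.sum_le_card_nsmul N _ 1 hcon
      rw [smul_eq_mul] at this
      omega
    obtain ⟨a, c, hac, hba, hbc, -⟩ := hpair b hbN (le_antisymm (hle b hbN) hb2)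
    obtain ⟨-, haN, hba'⟩ := hmem hba
    obtain ⟨-, hcN, hbc'⟩ := hmem hbc
    have hN : ∀ x, G.Adj v x ↔ x = a ∨ x = b ∨ x = c := by
      simpa using hfill {a, b, c} (by simp [Finset.insert_subset_iff, haN, hbN, hcN])
        (by rw [h3, Finset.card_eq_three.mpr ⟨a, b, c, hba'.symm, hac, hbc', rfl⟩])
    exact Or.inl (hasReduction_of_path h hN (hswap hba) hbc hac)
  · obtain ⟨a, b, c, d, hN, hab, hbc, hcd, hda, hac, hbd⟩ := exists_four_cycle (N := N)
      (E := fun x y => {v, x, y} ∈ T) hswap hmem (fun x hx => hpair x hx (hall (by omega) x hx)) h4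
    exact Or.inl (hasReduction_of_four_cycle h (fun x => (hNm x).symm.trans (hN x)) hab hbc hcd hda
      hac hbd)
  · have hall := hall (by omega)
    obtain ⟨a, b, c, d, e, hN, hab, hbc, hcd, hde, hea, hac, hbd, had, hbe, hce⟩ :=
      exists_five_cycle (N := N) (E := fun x y => {v, x, y} ∈ T) hswap hmem
        (fun x hx => hpair x hx (hall x hx)) h5
    refine (hasReduction_or_isBad_of_five_cycle h (fun x => (hNm x).symm.trans (hN x)) hab hbc hcd
      hde hea hac hbd had hbe hce (hall a (hmem hab).1)).imp_right fun hbad => ⟨h5, ?_, a, hbad⟩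
    rw [h5]
    push_cast
    omega

theorem IsBad.mem_of_mem {V : Type} [DecidableEq V] {G : SimpleGraph V} {T : Finset (Finset V)}
    {v p : V} (hb : IsBad G T v p) (h : IsAcyclicComplex G T) {t : Finset V} (ht : t ∈ T)
    (hp : p ∈ t) : v ∈ t := by
  by_contra hv
  have hpos : 0 < (t.erase p).card := by
    rw [Finset.card_erase_of_mem hp, (h.clique t ht).card_eq]
    norm_num
  obtain ⟨x, hx⟩ := Finset.card_pos.mp hpos
  obtain ⟨hxp, hxt⟩ := Finset.mem_erase.mp hx
  obtain ⟨y, hyp, hyx, rfl⟩ := h.exists_third ht hp hxt hxp.symm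
  obtain ⟨hpx, hxy, hpy⟩ := h.adj_of_triple ht
  simp only [Finset.mem_insert, Finset.mem_singleton, not_or] at hv
  exact hb.2.2 x y hpx hpy (Ne.symm hv.2.1) (Ne.symm hv.2.2) hxy

theorem IsBad.card_triangles {V : Type} [DecidableEq V] {G : SimpleGraph V}
    {T : Finset (Finset V)} {v p : V} (hb : IsBad G T v p) (h : IsAcyclicComplex G T) :
    (T.filter fun t => p ∈ t).card = 2 := by
  rw [← hb.2.1]
  congr 1
  exact Finset.filter_congr fun t ht => ⟨fun hp => ⟨hb.mem_of_mem h ht hp, hp⟩, And.right⟩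

theorem IsBad.unique {V : Type} [DecidableEq V] {G : SimpleGraph V} {T : Finset (Finset V)}
    {v w p : V} (hv : IsBad G T v p) (hw : IsBad G T w p) (h : IsAcyclicComplex G T) : v = w := by
  by_contra hne
  obtain ⟨y, z, hyz, hy, hz, -⟩ := h.exists_link_pair hv.1.ne hv.2.1
  have h1 := hw.mem_of_mem h hy (by simp)
  have h2 := hw.mem_of_mem h hz (by simp)
  have h3 := hw.1.ne
  simp only [Finset.mem_insert, Finset.mem_singleton] at h1 h2
  grind

theorem IsBad.three_le_ncard_neighborSet {V : Type} [Finite V] [DecidableEq V]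
    {G : SimpleGraph V} {T : Finset (Finset V)} {v p : V} (hb : IsBad G T v p)
    (h : IsAcyclicComplex G T) : 3 ≤ (G.neighborSet p).ncard := by
  obtain ⟨y, z, hyz, hy, hz, -⟩ := h.exists_link_pair hb.1.ne hb.2.1
  obtain ⟨-, hpy, hvy⟩ := h.adj_of_triple hy
  obtain ⟨-, hpz, hvz⟩ := h.adj_of_triple hz
  exact (Set.two_lt_ncard_iff (Set.toFinite _)).mpr
    ⟨v, y, z, hb.1.symm, hpy, hpz, hvy.ne, hvz.ne, hyz⟩

theorem IsAcyclicComplex.exists_hasReduction {V : Type} [Fintype V] [DecidableEq V]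
    {G : SimpleGraph V} {T : Finset (Finset V)} (h : IsAcyclicComplex G T)
    (hne : G.support.Nonempty) : ∃ v, HasReduction G T v := by
  by_contra! hred
  have hbad : ∀ v ∈ G.support, 0 < charge G T v →
      (G.neighborSet v).ncard = 5 ∧ charge G T v = 1 ∧ ∃ p, IsBad G T v p := fun v hv hc =>
    (h.hasReduction_or_isBad hv hc).resolve_left (hred v)
  let S := (Set.toFinite G.support).toFinset
  have hS : ∀ v, v ∈ S ↔ v ∈ G.support := fun v => Set.Finite.mem_toFinset _
  let P := S.filter fun v => 0 < charge G T v
  have hP : ∀ v ∈ P, ∃ p, IsBad G T v p := fun v hv =>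
    (hbad v ((hS v).mp (Finset.mem_filter.mp hv).1) (Finset.mem_filter.mp hv).2).2.2
  choose! f hf using hP
  have hinj : Set.InjOn f P := fun v hv w hw hvw => (hf v hv).unique (hvw ▸ hf w hw) h
  have hfS : ∀ v ∈ P, f v ∈ S := fun v hv => (hS _).mpr ⟨v, (hf v hv).1.symm⟩
  have hfc : ∀ v ∈ P, charge G T (f v) < 0 := by
    intro v hv
    have h3 := (hf v hv).three_le_ncard_neighborSet h
    have h2 := (hf v hv).card_triangles h
    have hc : charge G T (f v) = 10 - 3 * (G.neighborSet (f v)).ncard := by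
      rw [charge, h2]
      push_cast
      ring
    by_cases hd : (G.neighborSet (f v)).ncard = 3
    · have := (hbad (f v) ((hS _).mp (hfS v hv)) (by rw [hc, hd]; norm_num)).1
      omega
    · omega
  have hle : ∀ v ∈ S, charge G T v ≤
      (if 0 < charge G T v then 1 else 0) - (if v ∈ P.image f then 1 else 0) := by
    intro v hv
    by_cases hq : v ∈ P.image f
    · obtain ⟨w, hw, rfl⟩ := Finset.mem_image.mp hq
      have := hfc w hw
      rw [if_neg this.not_gt, if_pos hq]
      omega
    · rw [if_neg hq]
      split_ifs with hpos
      · rw [(hbad v ((hS v).mp hv) hpos).2.1]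
        norm_num
      · omega
  have hsum := (h.sum_charge_pos hne).trans_le (Finset.sum_le_sum hle)
  have himg : S.filter (fun v => v ∈ P.image f) = P.image f := by
    rw [Finset.filter_mem_eq_inter, Finset.inter_eq_right]
    exact Finset.image_subset_iff.mpr hfS
  rw [Finset.sum_sub_distrib, Finset.sum_boole, Finset.sum_boole, himg,
    Finset.card_image_of_injOn hinj] at hsum
  exact (sub_self _).not_gt hsum

/-- Every graph carrying an acyclic complex is list 3-dynamically 6-colorable. -/
theorem IsAcyclicComplex.exists_isDynColoring {V : Type} [Fintype V] [DecidableEq V]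
    {G : SimpleGraph V} {T : Finset (Finset V)} (h : IsAcyclicComplex G T) (L : V → Finset ℕ)
    (hL : ∀ v, 6 ≤ (L v).card) : ∃ φ : V → ℕ, (∀ v, φ v ∈ L v) ∧ IsDynColoring G 3 φ := by
  induction hn : G.edgeSet.ncard using Nat.strong_induction_on generalizing G T with
  | _ n ih =>
    subst hn
    rcases G.support.eq_empty_or_nonempty with h0 | hne
    · have hno : ∀ x y, ¬ G.Adj x y := fun x y hxy =>
        (h0 ▸ (⟨y, hxy⟩ : x ∈ G.support) : x ∈ (∅ : Set V))
      have hpos : ∀ v, (L v).Nonempty := fun v => Finset.card_pos.mp ((hL v).trans_lt' (by norm_num))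
      choose φ hφ using hpos
      refine ⟨φ, hφ, fun u v huv => absurd huv (hno u v), fun v => ?_⟩
      rw [show G.neighborSet v = ∅ from Set.eq_empty_of_forall_notMem (hno v)]
      simp
    · obtain ⟨v, p, hvp, hlink, hred⟩ := h.exists_hasReduction hne
      obtain ⟨φ, hφL, hφ⟩ := ih _ (ncard_edgeSet_contractGraph_lt hvp) (h.contract hvp hlink) rfl
      obtain ⟨γ, hγ, hdyn⟩ := hred φ hφ (L v) (hL v)
      refine ⟨_, fun u => ?_, hdyn⟩
      by_cases hu : u = v
      · subst hu
        rwa [Function.update_self]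
      · rw [Function.update_of_ne hu]
        exact hφL u

theorem finrank_le_one_of_forall_eq {ι : Type*} [Finite ι]
    {W : Submodule (ZMod 2) (ι → ZMod 2)} (hW : ∀ w ∈ W, ∀ i j, w i = w j) :
    Module.finrank (ZMod 2) W ≤ 1 := by
  have hle : W ≤ Submodule.span (ZMod 2) {fun _ => 1} := by
    intro w hw
    refine Submodule.mem_span_singleton.mpr ?_
    rcases isEmpty_or_nonempty ι with h | ⟨⟨i⟩⟩
    · exact ⟨0, funext fun i => h.elim i⟩
    · exact ⟨w i, funext fun j => (mul_one _).trans (hW w hw i j)⟩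
  refine (Submodule.finrank_mono hle).trans ((finrank_span_le_card _).trans ?_)
  simp

/-- The coboundary of functions on the vertices of a graph. -/
def vertexCoboundary {V : Type} (G : SimpleGraph V) :
    (V → ZMod 2) →ₗ[ZMod 2] (G.edgeSet → ZMod 2) where
  toFun f e := e.1.lift ⟨fun x y => f x + f y, fun _ _ => add_comm _ _⟩
  map_add' f g := by
    ext ⟨e, he⟩
    induction e with | _ x y
    exact add_add_add_comm _ _ _ _
  map_smul' c f := by
    ext ⟨e, he⟩
    induction e with | _ x y
    exact (mul_add _ _ _).symm

theorem eq_of_vertexCoboundary_eq_zero {V : Type} {G : SimpleGraph V} (hG : G.Connected)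
    {f : V → ZMod 2} (hf : vertexCoboundary G f = 0) (x y : V) : f x = f y := by
  obtain ⟨p⟩ := hG.preconnected x y
  induction p with
  | nil => rfl
  | @cons u v w h p ih =>
    exact (CharTwo.add_eq_zero.mp (congrFun hf ⟨s(u, v), h⟩)).trans ih

namespace RotationSystem

/-- The face whose boundary walk contains a given dart. -/
def face {V : Type} [Fintype V] [DecidableEq V] (P : RotationSystem V) (d : P.graph.Dart) :
    Quotient P.faceSetoid :=
  Quotient.mk _ d

theorem face_eq_face {V : Type} [Fintype V] [DecidableEq V] (P : RotationSystem V)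
    {d e : P.graph.Dart} : P.face d = P.face e ↔ P.SameFace d e :=
  Quotient.eq

theorem facePerm_fst {V : Type} [Fintype V] [DecidableEq V] (P : RotationSystem V)
    (d : P.graph.Dart) : (P.facePerm d).fst = d.snd :=
  P.rot_fst d.symm

theorem face_facePerm {V : Type} [Fintype V] [DecidableEq V] (P : RotationSystem V)
    (d : P.graph.Dart) : P.face (P.facePerm d) = P.face d :=
  P.face_eq_face.mpr (Equiv.Perm.sameCycle_apply_left.mpr (Equiv.Perm.SameCycle.refl _ _))

theorem face_rot {V : Type} [Fintype V] [DecidableEq V] (P : RotationSystem V)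
    (d : P.graph.Dart) : P.face (P.rot d) = P.face d.symm := by
  rw [← P.face_facePerm d.symm]
  exact congrArg (fun e => P.face (P.rot e)) d.symm_symm.symm

/-- A function on the faces which takes the same value on both sides of every edge is constant. -/
theorem eq_of_forall_face_symm_eq {V : Type} [Fintype V] [DecidableEq V] (P : RotationSystem V)
    {α : Type*} {s : Quotient P.faceSetoid → α} (hs : ∀ d, s (P.face d) = s (P.face d.symm))
    (q r : Quotient P.faceSetoid) : s q = s r := by
  have hrot : ∀ (n : ℕ) d, s (P.face ((P.rot ^ n) d)) = s (P.face d) := by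
    intro n d
    induction n with
    | zero => rfl
    | succ n ih => rw [pow_succ', Equiv.Perm.mul_apply, face_rot, ← hs, ih]
  have hfst : ∀ d e : P.graph.Dart, d.fst = e.fst → s (P.face d) = s (P.face e) := by
    intro d e hde
    obtain ⟨n, rfl⟩ := P.rot_orbit d e hde
    exact (hrot n d).symm
  have hwalk : ∀ {u w : V} (_ : P.graph.Walk u w) (d e : P.graph.Dart), d.fst = u → e.fst = w →
      s (P.face d) = s (P.face e) := by
    intro u w p
    induction p with
    | nil => exact fun d e hd he => hfst d e (hd.trans he.symm)
    | @cons u v w h p ih =>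
      intro d e hd he
      rw [hfst d ⟨(u, v), h⟩ hd, hs]
      exact ih _ e rfl he
  induction q using Quotient.inductionOn with | _ d
  induction r using Quotient.inductionOn with | _ e
  obtain ⟨p⟩ := P.conn.preconnected d.fst e.fst
  exact hwalk p d e rfl rfl

open Classical in
/-- A 1-cochain of a plane graph which vanishes on every face boundary is a coboundary. -/
theorem exists_eq_add_of_sum_face_eq_zero {V : Type} [Fintype V] [DecidableEq V]
    (P : RotationSystem V) (hP : P.IsPlane) {ε : Sym2 V → ZMod 2}
    (hε : ∀ q, ∑ d with P.face d = q, ε d.edge = 0) :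
    ∃ f : V → ZMod 2, ∀ x y, P.graph.Adj x y → ε s(x, y) = f x + f y := by
  let _ : Fintype (Quotient P.faceSetoid) := Fintype.ofFinite _
  let M : Matrix (Quotient P.faceSetoid) P.graph.edgeSet (ZMod 2) := Matrix.of fun q e =>
    ∑ d : P.graph.Dart, if P.face d = q ∧ d.edge = e then 1 else 0
  have hM : ∀ η q, M.mulVec η q = ∑ d with P.face d = q, η ⟨d.edge, d.edge_mem⟩ := by
    intro η q
    simp only [Matrix.mulVec, dotProduct, M, Matrix.of_apply, Finset.sum_mul, ite_mul, one_mul,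
      zero_mul]
    rw [Finset.sum_comm, Finset.sum_filter]
    refine Finset.sum_congr rfl fun d _ => ?_
    split_ifs with hd
    · rw [Finset.sum_eq_single ⟨d.edge, d.edge_mem⟩]
      · rw [if_pos ⟨hd, rfl⟩]
      · exact fun e _ he => if_neg fun h => he (Subtype.ext h.2.symm)
      · exact fun h => absurd (Finset.mem_univ _) h
    · exact Finset.sum_eq_zero fun e _ => if_neg fun h => hd h.1
  have hMt : ∀ s d, M.transpose.mulVec s ⟨d.edge, d.edge_mem⟩ =
      s (P.face d) + s (P.face d.symm) := by
    intro s d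
    simp only [Matrix.mulVec, dotProduct, M, Matrix.transpose_apply, Matrix.of_apply,
      Finset.sum_mul, ite_mul, one_mul, zero_mul]
    rw [Finset.sum_comm, ← Finset.sum_pair (f := fun e => s (P.face e)) d.symm_ne.symm, ← Finset.sum_subset
      (Finset.subset_univ {d, d.symm})]
    · refine Finset.sum_congr rfl fun e he => ?_
      have hed : e.edge = d.edge := by
        rw [dart_edge_eq_iff]
        simpa using he
      rw [Finset.sum_eq_single (P.face e)]
      · rw [if_pos ⟨rfl, hed⟩]
      · exact fun q _ hq => if_neg fun h => hq h.1.symm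
      · exact fun h => absurd (Finset.mem_univ _) h
    · intro e _ he
      refine Finset.sum_eq_zero fun q _ => if_neg fun h => he ?_
      simpa using (dart_edge_eq_iff e d).mp h.2
  have hker : Module.finrank (ZMod 2) M.transpose.mulVecLin.ker ≤ 1 := by
    refine finrank_le_one_of_forall_eq fun s hs => P.eq_of_forall_face_symm_eq fun d => ?_
    exact CharTwo.add_eq_zero.mp ((hMt s d).symm.trans
      (congrFun (LinearMap.mem_ker.mp hs) ⟨d.edge, d.edge_mem⟩))
  have hker0 : Module.finrank (ZMod 2) (vertexCoboundary P.graph).ker ≤ 1 :=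
    finrank_le_one_of_forall_eq fun f hf => eq_of_vertexCoboundary_eq_zero P.conn hf
  have h1 := M.transpose.mulVecLin.finrank_range_add_finrank_ker
  have h2 := M.mulVecLin.finrank_range_add_finrank_ker
  have h3 := (vertexCoboundary P.graph).finrank_range_add_finrank_ker
  have h4 : Module.finrank (ZMod 2) M.transpose.mulVecLin.range =
      Module.finrank (ZMod 2) M.mulVecLin.range := M.rank_transpose
  rw [IsPlane, numFaces, Nat.card_eq_fintype_card, Nat.card_eq_fintype_card] at hP
  rw [Module.finrank_fintype_fun_eq_card] at h1 h2 h3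
  have hle : (vertexCoboundary P.graph).range ≤ M.mulVecLin.ker := by
    rintro _ ⟨f, rfl⟩
    refine LinearMap.mem_ker.mpr (funext fun q => (hM _ q).trans ?_)
    have hd : ∀ d : P.graph.Dart, vertexCoboundary P.graph f ⟨d.edge, d.edge_mem⟩ =
        f d.fst + f (P.facePerm d).fst := fun d => by
      rw [facePerm_fst]
      rfl
    rw [Finset.sum_congr rfl fun d _ => hd d, Finset.sum_add_distrib]
    refine CharTwo.add_eq_zero.mpr ?_
    simp only [Finset.sum_filter]
    rw [← Equiv.sum_comp P.facePerm]
    simp only [face_facePerm]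
  have heq := Submodule.eq_of_le_of_finrank_le hle (by omega)
  have hmem : (fun e : P.graph.edgeSet => ε e) ∈ M.mulVecLin.ker :=
    LinearMap.mem_ker.mpr (funext fun q => (hM _ q).trans (hε q))
  rw [← heq] at hmem
  obtain ⟨f, hf⟩ := hmem
  exact ⟨f, fun x y hxy => (congrFun hf ⟨s(x, y), hxy⟩).symm⟩

theorem facePerm_of_faceSize_eq_three {V : Type} [Fintype V] [DecidableEq V]
    (P : RotationSystem V) {d : P.graph.Dart} (hd : P.faceSize d = 3) :
    P.facePerm (P.facePerm (P.facePerm d)) = d ∧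
      ∀ e, P.SameFace d e ↔ e = d ∨ e = P.facePerm d ∨ e = P.facePerm (P.facePerm d) := by
  classical
  let s : Finset P.graph.Dart := Finset.univ.filter fun e => P.facePerm.SameCycle d e
  have hs : P.facePerm.IsCycleOn (s : Set P.graph.Dart) := by
    refine ⟨P.facePerm.bijOn fun e => ?_, fun x hx y hy => ?_⟩
    · simp [s, Equiv.Perm.sameCycle_apply_right]
    · simp only [s, Finset.coe_filter, Finset.mem_univ, true_and, Set.mem_ofPred_eq] at hx hy
      exact hx.symm.trans hy
  have hds : d ∈ s := Finset.mem_filter.mpr ⟨Finset.mem_univ _, Equiv.Perm.SameCycle.refl _ _⟩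
  have hcard : s.card = 3 := by
    rw [← hd, faceSize, ← Set.ncard_coe_finset]
    congr 1
    ext e
    simp [s, SameFace]
  refine ⟨?_, fun e => ⟨fun he => ?_, ?_⟩⟩
  · have := hs.pow_card_apply hds
    rwa [hcard] at this
  · obtain ⟨n, hn, rfl⟩ := hs.exists_pow_eq hds (Finset.mem_filter.mpr ⟨Finset.mem_univ _, he⟩ : e ∈ s)
    rw [hcard] at hn
    interval_cases n
    exacts [Or.inl rfl, Or.inr (Or.inl rfl), Or.inr (Or.inr rfl)]
  · rw [← face_eq_face]
    rintro (rfl | rfl | rfl) <;> simp only [face_facePerm]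

/-- The vertices of the face of a dart, if this face is a triangle. -/
def triangle {V : Type} [Fintype V] [DecidableEq V] (P : RotationSystem V)
    (d : P.graph.Dart) : Finset V :=
  {d.fst, d.snd, (P.facePerm d).snd}

theorem triangle_facePerm {V : Type} [Fintype V] [DecidableEq V] (P : RotationSystem V)
    {d : P.graph.Dart} (hd : P.faceSize d = 3) : P.triangle (P.facePerm d) = P.triangle d := by
  have h3 := (P.facePerm_of_faceSize_eq_three hd).1
  rw [triangle, triangle, facePerm_fst, ← facePerm_fst P (P.facePerm (P.facePerm d)), h3]
  ext x
  simp only [Finset.mem_insert, Finset.mem_singleton]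
  tauto

theorem faceSize_facePerm {V : Type} [Fintype V] [DecidableEq V] (P : RotationSystem V)
    (d : P.graph.Dart) : P.faceSize (P.facePerm d) = P.faceSize d := by
  simp only [faceSize, ← face_eq_face, face_facePerm]

theorem triangle_adj {V : Type} [Fintype V] [DecidableEq V] (P : RotationSystem V)
    {d : P.graph.Dart} (hd : P.faceSize d = 3) :
    P.graph.Adj d.snd (P.facePerm d).snd ∧ P.graph.Adj (P.facePerm d).snd d.fst := by
  have h3 := (P.facePerm_of_faceSize_eq_three hd).1
  refine ⟨facePerm_fst P d ▸ (P.facePerm d).adj, ?_⟩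
  have := (P.facePerm (P.facePerm d)).adj
  rwa [facePerm_fst, ← facePerm_fst P (P.facePerm (P.facePerm d)), h3] at this

theorem exists_edge_eq_of_mem_triangle {V : Type} [Fintype V] [DecidableEq V]
    (P : RotationSystem V) {d : P.graph.Dart} (hd : P.faceSize d = 3) {x y : V} (hxy : x ≠ y)
    (hx : x ∈ P.triangle d) (hy : y ∈ P.triangle d) :
    ∃ e, e.edge = s(x, y) ∧ P.triangle e = P.triangle d := by
  have h1 := P.triangle_facePerm hd
  have h2 := P.triangle_facePerm ((P.faceSize_facePerm d).trans hd)
  have h3 : (P.facePerm (P.facePerm d)).snd = d.fst := by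
    rw [← facePerm_fst, (P.facePerm_of_faceSize_eq_three hd).1]
  have e1 : (P.facePerm d).edge = s(d.snd, (P.facePerm d).snd) := by
    rw [← facePerm_fst]; rfl
  have e2 : (P.facePerm (P.facePerm d)).edge = s((P.facePerm d).snd, d.fst) := by
    rw [← facePerm_fst, ← h3]; rfl
  have key : ∀ e : P.graph.Dart, ∀ a b, e.edge = s(a, b) → P.triangle e = P.triangle d →
      (x = a ∧ y = b ∨ x = b ∧ y = a) → ∃ e, e.edge = s(x, y) ∧ P.triangle e = P.triangle d :=
    fun e a b he ht h => ⟨e, he.trans (Sym2.eq_iff.mpr h).symm, ht⟩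
  have k1 := key d _ _ rfl rfl
  have k2 := key _ _ _ e1 h1
  have k3 := key _ _ _ e2 (h2.trans h1)
  simp only [triangle, Finset.mem_insert, Finset.mem_singleton] at hx hy
  rcases hx with hx | hx | hx <;> rcases hy with hy | hy | hy
  exacts [absurd (hx.trans hy.symm) hxy, k1 (Or.inl ⟨hx, hy⟩), k3 (Or.inr ⟨hx, hy⟩),
    k1 (Or.inr ⟨hx, hy⟩), absurd (hx.trans hy.symm) hxy, k2 (Or.inl ⟨hx, hy⟩),
    k3 (Or.inl ⟨hx, hy⟩), k2 (Or.inr ⟨hx, hy⟩), absurd (hx.trans hy.symm) hxy]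

end RotationSystem

open Classical in
/-- The triangles bounding the bounded faces of a near-triangulation. -/
noncomputable def NearTriangulation.triangles {V : Type} [Fintype V] [DecidableEq V]
    (P : NearTriangulation V) : Finset (Finset V) :=
  (Finset.univ.filter fun d => ¬ P.SameFace P.outer d).image P.triangle

theorem NearTriangulation.mem_triangles {V : Type} [Fintype V] [DecidableEq V]
    (P : NearTriangulation V) {t : Finset V} :
    t ∈ P.triangles ↔ ∃ d, ¬ P.SameFace P.outer d ∧ P.triangle d = t := by
  simp [NearTriangulation.triangles]

theorem NearTriangulation.isAcyclicComplex {V : Type} [Fintype V] [DecidableEq V]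
    (P : NearTriangulation V) : IsAcyclicComplex P.graph P.triangles := by
  classical
  refine ⟨fun t ht => ?_, fun x y hxy => ?_, fun ε hε => ?_⟩
  · obtain ⟨d, hd, rfl⟩ := P.mem_triangles.mp ht
    obtain ⟨h1, h2⟩ := P.triangle_adj (P.bounded_tri d hd)
    exact is3Clique_iff.mpr ⟨_, _, _, d.adj, h2.symm, h1, rfl⟩
  · by_cases hadj : P.graph.Adj x y
    · let e : P.graph.Dart := ⟨(x, y), hadj⟩
      refine (Finset.card_le_card (t := {P.triangle e, P.triangle e.symm}) fun t ht => ?_).trans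
        Finset.card_le_two
      obtain ⟨ht, hx, hy⟩ := Finset.mem_filter.mp ht
      obtain ⟨d, hd, rfl⟩ := P.mem_triangles.mp ht
      obtain ⟨c, hc, hcd⟩ := P.exists_edge_eq_of_mem_triangle (P.bounded_tri d hd) hxy hx hy
      rw [← hcd]
      rcases (dart_edge_eq_iff c e).mp hc with rfl | rfl <;> simp
    · refine (Finset.card_eq_zero.mpr (Finset.filter_eq_empty_iff.mpr ?_)).le.trans zero_le_two
      rintro t ht ⟨hx, hy⟩
      obtain ⟨d, hd, rfl⟩ := P.mem_triangles.mp ht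
      obtain ⟨c, hc, -⟩ := P.exists_edge_eq_of_mem_triangle (P.bounded_tri d hd) hxy hx hy
      exact hadj (P.graph.mem_edgeSet.mp (hc ▸ c.edge_mem))
  · have hbdd : ∀ q, q ≠ P.face P.outer → ∑ d with P.face d = q, ε d.edge = 0 := by
      intro q hq
      induction q using Quotient.inductionOn with | _ d
      change P.face d ≠ _ at hq
      change ∑ e with P.face e = P.face d, ε e.edge = 0
      have hd : ¬ P.SameFace P.outer d := fun h => hq (P.face_eq_face.mpr h).symm
      have h3 := P.bounded_tri d hd
      obtain ⟨hF, hface⟩ := P.facePerm_of_faceSize_eq_three h3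
      obtain ⟨h1, h2⟩ := P.triangle_adj h3
      have hs := hε _ _ _ (P.mem_triangles.mpr ⟨d, hd, rfl⟩)
      have hfst : (P.facePerm (P.facePerm d)).snd = d.fst := by
        rw [← P.facePerm_fst, hF]
      have e1 : (P.facePerm d).edge = s(d.snd, (P.facePerm d).snd) := by
        rw [← P.facePerm_fst]; rfl
      have e2 : (P.facePerm (P.facePerm d)).edge = s(d.fst, (P.facePerm d).snd) := by
        rw [← P.facePerm_fst, ← hfst]; exact Sym2.eq_swap
      have hset : (Finset.univ.filter fun e => P.face e = P.face d) =
          {d, P.facePerm d, P.facePerm (P.facePerm d)} := by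
        ext e
        rw [Finset.mem_filter, eq_comm (a := P.face e), P.face_eq_face, hface]
        simp
      have hne1 : d ≠ P.facePerm d := fun h => d.adj.ne (by
        rw [← P.facePerm_fst d, ← h])
      have hne2 : d ≠ P.facePerm (P.facePerm d) := fun h => h2.ne (by
        rw [← P.facePerm_fst (P.facePerm d), ← h])
      have hne3 : P.facePerm d ≠ P.facePerm (P.facePerm d) := fun h =>
        hne1 (P.facePerm.injective h)
      rw [hset, Finset.sum_insert (by simp [hne1, hne2]), Finset.sum_pair hne3, e1, e2, ← add_assoc]
      exact hs
    have htot : ∑ d : P.graph.Dart, ε d.edge = 0 :=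
      Finset.sum_involution (fun d _ => d.symm)
        (fun d _ => by rw [Dart.edge_symm]; exact CharTwo.add_self_eq_zero _)
        (fun d _ _ => d.symm_ne) (fun _ _ => Finset.mem_univ _) (fun d _ => d.symm_symm)
    refine P.exists_eq_add_of_sum_face_eq_zero P.plane fun q => ?_
    by_cases hq : q = P.face P.outer
    · subst hq
      let _ : Fintype (Quotient P.faceSetoid) := Fintype.ofFinite _
      rw [← Finset.sum_fiberwise Finset.univ P.face,
        Finset.sum_eq_single (P.face P.outer) (fun q _ hq => hbdd q hq)
          (fun h => absurd (Finset.mem_univ _) h)] at htot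
      exact htot
    · exact hbdd q hq

/-- **Theorem 1.3 (Gu–Kim–Ma–Shi).** If `G` is a near-triangulation, then `ch₃ᵈ(G) ≤ 6`:
for every list assignment giving each vertex at least `6` colors, `G` admits a proper coloring
from the lists in which every vertex sees at least `min 3 (deg v)` colors on its neighborhood. -/
theorem nearTriangulation_list_three_dynamic_six {V : Type} [Fintype V] [DecidableEq V]
    (P : NearTriangulation V) (L : V → Finset ℕ) (hL : ∀ v : V, 6 ≤ (L v).card) :
    ∃ φ : V → ℕ, (∀ v : V, φ v ∈ L v) ∧ IsDynColoring P.graph 3 φ := by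
  exact P.isAcyclicComplex.exists_isDynColoring L hL
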